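/- arXiv:math/0701485 — 11 statements merged into one kernel-verified Lean document; each statement's English description precedes it below -/
import Mathlib

section
/- If (F_ε)_{ε∈(0,1]} is a c-bounded net of maps from Ω₁ into Ω₂ that is locally equi-continuous on Ω₁, then its generalized graph can be determined pointwise: C_F = {(x,y) ∈ Ω₁ × Ω₂ : y is a cluster point of the net (F_ε(x))_{ε∈(0,1]} as ε → 0}. -/
open Set Filter Topology

/-- `y` is a cluster point of the net `(z ε)_{ε ∈ (0,1]}` as `ε → 0`: for every
neighborhood `U` of `y` and every `ε₀ ∈ (0,1]` there is `ε < ε₀` (with `ε > 0`)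
such that `z ε ∈ U`. -/
def IsClusterPtNet {F : Type*} [TopologicalSpace F] (z : ℝ → F) (y : F) : Prop :=
  ∀ U ∈ nhds y, ∀ ε₀ ∈ Set.Ioc (0:ℝ) 1, ∃ ε, 0 < ε ∧ ε < ε₀ ∧ z ε ∈ U

/-- The net of maps `(Fnet ε)_{ε ∈ (0,1]}` is c-bounded from `Ω₁` into `Ω₂`:
for every compact `K ⊆ Ω₁` there are a compact `K' ⊆ Ω₂` and `ε₀ > 0` such that
`Fnet ε '' K ⊆ K'` for all `ε ∈ (0,1]` with `ε ≤ ε₀`. -/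
def CBounded {E F : Type*} [TopologicalSpace E] [TopologicalSpace F]
    (Fnet : ℝ → E → F) (Ω₁ : Set E) (Ω₂ : Set F) : Prop :=
  ∀ K ⊆ Ω₁, IsCompact K → ∃ K' ⊆ Ω₂, IsCompact K' ∧
    ∃ ε₀ > (0:ℝ), ∀ ε ∈ Set.Ioc (0:ℝ) 1, ε ≤ ε₀ → Fnet ε '' K ⊆ K'

/-- The generalized graph `C_F` of the net `(Fnet ε)_{ε∈(0,1]}` relative to `Ω₁, Ω₂`:
all pairs `(x,y) ∈ Ω₁ × Ω₂` such that there exist a net `(x_ε)` in `Ω₁` tending to `x`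
as `ε → 0` and a map `τ : (0,1] → (0,1]` with `τ ε ≤ ε`, such that `y` is a cluster
point of `(Fnet (τ ε) (x_ε))_{ε}`. -/
def GenGraph {E F : Type*} [TopologicalSpace E] [TopologicalSpace F]
    (Fnet : ℝ → E → F) (Ω₁ : Set E) (Ω₂ : Set F) : Set (E × F) :=
  {p | p.1 ∈ Ω₁ ∧ p.2 ∈ Ω₂ ∧ ∃ (x : ℝ → E) (τ : ℝ → ℝ),
    (∀ ε ∈ Set.Ioc (0:ℝ) 1, x ε ∈ Ω₁) ∧
    (∀ ε ∈ Set.Ioc (0:ℝ) 1, τ ε ∈ Set.Ioc (0:ℝ) 1 ∧ τ ε ≤ ε) ∧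
    Filter.Tendsto x (nhdsWithin 0 (Set.Ioc (0:ℝ) 1)) (nhds p.1) ∧
    IsClusterPtNet (fun ε => Fnet (τ ε) (x ε)) p.2}

/-- The net `(Fnet ε)` is equi-continuous at `x₀`: for every `γ > 0` there is `δ > 0`
with `‖Fnet ε x - Fnet ε x₀‖ < γ` for all `x ∈ Ω₁` with `‖x - x₀‖ < δ` and all
`ε ∈ (0,1]`. -/
def EquiContAt {E F : Type*} [NormedAddCommGroup E] [NormedAddCommGroup F]
    (Fnet : ℝ → E → F) (Ω₁ : Set E) (x₀ : E) : Prop :=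
  ∀ γ > (0:ℝ), ∃ δ > (0:ℝ), ∀ x ∈ Ω₁, ‖x - x₀‖ < δ →
    ∀ ε ∈ Set.Ioc (0:ℝ) 1, ‖Fnet ε x - Fnet ε x₀‖ < γ

/-- At a point of equi-continuity, cluster points of `Fnet (τ ε) (x ε)`, with `x ε → x₀` and
`τ ε ≤ ε`, are cluster points of the pointwise net `Fnet ε x₀`. -/
theorem EquiContAt.isClusterPtNet {E F : Type*} [NormedAddCommGroup E] [NormedAddCommGroup F]
    {Fnet : ℝ → E → F} {Ω₁ : Set E} {x₀ : E} {y : F} {x : ℝ → E} {τ : ℝ → ℝ}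
    (h : EquiContAt Fnet Ω₁ x₀) (hx : ∀ ε ∈ Set.Ioc (0:ℝ) 1, x ε ∈ Ω₁)
    (hτ : ∀ ε ∈ Set.Ioc (0:ℝ) 1, τ ε ∈ Set.Ioc (0:ℝ) 1 ∧ τ ε ≤ ε)
    (hlim : Tendsto x (𝓝[Set.Ioc (0:ℝ) 1] 0) (𝓝 x₀))
    (hy : IsClusterPtNet (fun ε => Fnet (τ ε) (x ε)) y) :
    IsClusterPtNet (fun ε => Fnet ε x₀) y := by
  intro U hU ε₀ hε₀
  obtain ⟨γ, hγ, hγU⟩ := Metric.mem_nhds_iff.mp hU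
  obtain ⟨δ, hδ, hequi⟩ := h (γ / 2) (half_pos hγ)
  obtain ⟨ε₁, hε₁, hclose⟩ :=
    Metric.mem_nhdsWithin_iff.mp (hlim (Metric.ball_mem_nhds x₀ hδ))
  obtain ⟨ε, hpos, hlt, hmem⟩ := hy (Metric.ball y (γ / 2))
    (Metric.ball_mem_nhds y (half_pos hγ)) (min ε₀ ε₁)
    ⟨lt_min hε₀.1 hε₁, (min_le_left _ _).trans hε₀.2⟩
  have hltε₀ : ε < ε₀ := hlt.trans_le (min_le_left _ _)
  have hltε₁ : ε < ε₁ := hlt.trans_le (min_le_right _ _)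
  have hε : ε ∈ Set.Ioc (0:ℝ) 1 := ⟨hpos, hltε₀.le.trans hε₀.2⟩
  obtain ⟨hτmem, hτle⟩ := hτ ε hε
  have hxε : x ε ∈ Metric.ball x₀ δ :=
    hclose ⟨by simpa [abs_of_pos hpos] using hltε₁, hε⟩
  have hnear := hequi (x ε) (hx ε hε) (mem_ball_iff_norm.mp hxε) (τ ε) hτmem
  refine ⟨τ ε, hτmem.1, hτle.trans_lt hltε₀, hγU ?_⟩
  rw [← dist_eq_norm, dist_comm] at hnear
  exact (dist_triangle _ _ _).trans_lt
    ((add_lt_add hnear (Metric.mem_ball.mp hmem)).trans_eq (add_halves γ))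

/-- The generalized graph contains all pointwise cluster points. -/
theorem IsClusterPtNet.mem_genGraph {E F : Type*} [TopologicalSpace E] [TopologicalSpace F]
    {Fnet : ℝ → E → F} {Ω₁ : Set E} {Ω₂ : Set F} {x : E} {y : F}
    (h : IsClusterPtNet (fun ε => Fnet ε x) y) (hx : x ∈ Ω₁) (hy : y ∈ Ω₂) :
    (x, y) ∈ GenGraph Fnet Ω₁ Ω₂ :=
  ⟨hx, hy, fun _ => x, id, fun _ _ => hx, fun _ hε => ⟨hε, le_rfl⟩, tendsto_const_nhds, h⟩

/-- If `(F_ε)` is a c-bounded net of (continuous) maps from `Ω₁` into `Ω₂` which is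
locally equi-continuous on `Ω₁`, then its generalized graph is determined pointwise:
`C_F = {(x,y) ∈ Ω₁ × Ω₂ : y is a cluster point of (F_ε(x))_ε}`. -/
theorem genGraph_eq_pointwise_of_locally_equicontinuous {n m : ℕ}
    (Ω₁ : Set (EuclideanSpace ℝ (Fin n))) (Ω₂ : Set (EuclideanSpace ℝ (Fin m)))
    (hΩ₁ : IsOpen Ω₁) (hΩ₂ : IsOpen Ω₂)
    (Fnet : ℝ → EuclideanSpace ℝ (Fin n) → EuclideanSpace ℝ (Fin m))
    (hcont : ∀ ε ∈ Set.Ioc (0:ℝ) 1, ContinuousOn (Fnet ε) Ω₁)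
    (hcb : CBounded Fnet Ω₁ Ω₂)
    (hequi : ∀ x₀ ∈ Ω₁, EquiContAt Fnet Ω₁ x₀) :
    GenGraph Fnet Ω₁ Ω₂ =
      {p | p.1 ∈ Ω₁ ∧ p.2 ∈ Ω₂ ∧ IsClusterPtNet (fun ε => Fnet ε p.1) p.2} := by
  ext ⟨x₀, y⟩
  constructor
  · rintro ⟨hx₀, hy, x, τ, hx, hτ, hlim, hcluster⟩
    exact ⟨hx₀, hy, (hequi x₀ hx₀).isClusterPtNet hx hτ hlim hcluster⟩
  · rintro ⟨hx₀, hy, hcluster⟩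
    exact hcluster.mem_genGraph hx₀ hy
end

section
/- Let (F_ε)_{ε∈(0,1]} be a c-bounded net of maps from Ω₁ into Ω₂. If (x₀,y₀) ∈ (Ω₁ × Ω₂) \ C_F, then there exist a neighborhood Y₀ ⊆ Ω₂ of y₀, a neighborhood X₀ ⊆ Ω₁ of x₀, and ε' > 0 such that Y₀ ∩ F_ε(X₀) = ∅ for all ε < ε'. -/
open Set Filter Topology

/-- If points arbitrarily close to `x₀` are mapped arbitrarily close to `y₀` by maps of the net
with arbitrarily small index, then `(x₀, y₀)` lies in the generalized graph. -/
theorem mem_genGraph_of_forall_exists_dist_lt {E F : Type*} [PseudoMetricSpace E]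
    [PseudoMetricSpace F] {Fnet : ℝ → E → F} {Ω₁ : Set E} {Ω₂ : Set F} {x₀ : E} {y₀ : F}
    (hx₀ : x₀ ∈ Ω₁) (hy₀ : y₀ ∈ Ω₂)
    (h : ∀ r > (0:ℝ), ∃ t ∈ Set.Ioc (0:ℝ) 1, t < r ∧
      ∃ x ∈ Ω₁, dist x x₀ < r ∧ dist (Fnet t x) y₀ < r) :
    (x₀, y₀) ∈ GenGraph Fnet Ω₁ Ω₂ := by
  have : Nonempty E := ⟨x₀⟩
  choose! τ hτ hτlt x hxΩ hx hy using h
  refine ⟨hx₀, hy₀, x, τ, fun ε hε => hxΩ ε hε.1, fun ε hε => ⟨hτ ε hε.1, (hτlt ε hε.1).le⟩,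
    ?_, ?_⟩
  · rw [Metric.tendsto_nhds]
    intro δ hδ
    filter_upwards [self_mem_nhdsWithin, mem_nhdsWithin_of_mem_nhds (Iio_mem_nhds hδ)]
      with ε hε hεδ
    exact (hx ε hε.1).trans hεδ
  · intro U hU ε₀ hε₀
    obtain ⟨δ, hδ, hball⟩ := Metric.mem_nhds_iff.1 hU
    obtain ⟨ε, hε, hlt⟩ := exists_between (lt_min hδ hε₀.1)
    exact ⟨ε, hε, hlt.trans_le (min_le_right _ _),
      hball ((hy ε hε).trans (hlt.trans_le (min_le_left _ _)))⟩

/-- If `(x₀,y₀) ∈ (Ω₁ × Ω₂) \ C_F`, then there are neighborhoods `Y₀ ⊆ Ω₂` of `y₀`,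
`X₀ ⊆ Ω₁` of `x₀` and `ε' > 0` with `Y₀ ∩ F_ε(X₀) = ∅` for all `ε < ε'`. -/
theorem exists_nbhds_disjoint_of_not_mem_genGraph {n m : ℕ}
    (Ω₁ : Set (EuclideanSpace ℝ (Fin n))) (Ω₂ : Set (EuclideanSpace ℝ (Fin m)))
    (hΩ₁ : IsOpen Ω₁) (hΩ₂ : IsOpen Ω₂)
    (Fnet : ℝ → EuclideanSpace ℝ (Fin n) → EuclideanSpace ℝ (Fin m))
    (hcont : ∀ ε ∈ Set.Ioc (0:ℝ) 1, ContinuousOn (Fnet ε) Ω₁)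
    (hcb : CBounded Fnet Ω₁ Ω₂)
    (x₀ : EuclideanSpace ℝ (Fin n)) (y₀ : EuclideanSpace ℝ (Fin m))
    (hx₀ : x₀ ∈ Ω₁) (hy₀ : y₀ ∈ Ω₂) (hnot : (x₀, y₀) ∉ GenGraph Fnet Ω₁ Ω₂) :
    ∃ Y₀ ⊆ Ω₂, Y₀ ∈ nhds y₀ ∧ ∃ X₀ ⊆ Ω₁, X₀ ∈ nhds x₀ ∧ ∃ ε' > (0:ℝ),
      ∀ ε ∈ Set.Ioc (0:ℝ) 1, ε < ε' → Y₀ ∩ Fnet ε '' X₀ = ∅ := by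
  by_contra hcon
  push Not at hcon
  refine hnot (mem_genGraph_of_forall_exists_dist_lt hx₀ hy₀ fun r hr => ?_)
  obtain ⟨t, ht, htr, y, ⟨hyr, -⟩, x, ⟨hxr, hxΩ⟩, rfl⟩ :=
    hcon (Metric.ball y₀ r ∩ Ω₂) inter_subset_right
      (inter_mem (Metric.ball_mem_nhds y₀ hr) (hΩ₂.mem_nhds hy₀))
      (Metric.ball x₀ r ∩ Ω₁) inter_subset_right
      (inter_mem (Metric.ball_mem_nhds x₀ hr) (hΩ₁.mem_nhds hx₀)) r hr
  exact ⟨t, ht, htr, x, hxΩ, hxr, hyr⟩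
end

section
/- Let (F_ε)_{ε∈(0,1]} be a c-bounded net of maps from Ω₁ into Ω₂ which is locally equi-continuous on Ω₁ and such that F_ε(x) → G(x) as ε → 0 for every x ∈ Ω₁, where G : Ω₁ → Ω₂ is continuous. Then the generalized graph of (F_ε) coincides with the classical graph of G, i.e. C_F = {(x, G(x)) : x ∈ Ω₁}. -/
open Set Filter Topology

theorem isClusterPtNet_iff_mapClusterPt {F : Type*} [TopologicalSpace F] {z : ℝ → F} {y : F} :
    IsClusterPtNet z y ↔ MapClusterPt y (𝓝[Ioc (0 : ℝ) 1] 0) z := by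
  rw [nhdsWithin_Ioc_eq_nhdsGT zero_lt_one, mapClusterPt_iff_frequently]
  refine forall₂_congr fun U _ => ?_
  rw [(nhdsGT_basis (0 : ℝ)).frequently_iff]
  constructor
  · intro h ε₀ hε₀
    obtain ⟨ε, hε, hlt, hU⟩ := h (min ε₀ 1) ⟨lt_min hε₀ one_pos, min_le_right _ _⟩
    exact ⟨ε, ⟨hε, hlt.trans_le (min_le_left _ _)⟩, hU⟩
  · intro h ε₀ hε₀
    obtain ⟨ε, ⟨hε, hlt⟩, hU⟩ := h ε₀ hε₀.1
    exact ⟨ε, hε, hlt, hU⟩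

/-- An equi-continuous net converging at `x₀` converges to the same limit along every net of
points tending to `x₀`, also after a reparametrization `τ ε ≤ ε`. -/
theorem EquiContAt.tendsto_comp {E F : Type*} [NormedAddCommGroup E] [NormedAddCommGroup F]
    {Fnet : ℝ → E → F} {Ω₁ : Set E} {x₀ : E} {y₀ : F} (hequi : EquiContAt Fnet Ω₁ x₀)
    (hlim : Tendsto (fun ε => Fnet ε x₀) (𝓝[Ioc (0 : ℝ) 1] 0) (𝓝 y₀))
    {x : ℝ → E} {τ : ℝ → ℝ} (hxΩ : ∀ ε ∈ Ioc (0 : ℝ) 1, x ε ∈ Ω₁)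
    (hτ : ∀ ε ∈ Ioc (0 : ℝ) 1, τ ε ∈ Ioc (0 : ℝ) 1 ∧ τ ε ≤ ε)
    (hx : Tendsto x (𝓝[Ioc (0 : ℝ) 1] 0) (𝓝 x₀)) :
    Tendsto (fun ε => Fnet (τ ε) (x ε)) (𝓝[Ioc (0 : ℝ) 1] 0) (𝓝 y₀) := by
  have hτlim : Tendsto τ (𝓝[Ioc (0 : ℝ) 1] 0) (𝓝[Ioc (0 : ℝ) 1] 0) := by
    refine tendsto_nhdsWithin_iff.2 ⟨?_, ?_⟩
    · refine tendsto_of_tendsto_of_tendsto_of_le_of_le' tendsto_const_nhds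
        (tendsto_id.mono_left nhdsWithin_le_nhds) ?_ ?_
      · filter_upwards [self_mem_nhdsWithin] with ε hε using (hτ ε hε).1.1.le
      · filter_upwards [self_mem_nhdsWithin] with ε hε using (hτ ε hε).2
    · filter_upwards [self_mem_nhdsWithin] with ε hε using (hτ ε hε).1
  have hdiff : Tendsto (fun ε => Fnet (τ ε) (x ε) - Fnet (τ ε) x₀)
      (𝓝[Ioc (0 : ℝ) 1] 0) (𝓝 0) := by
    rw [NormedAddGroup.tendsto_nhds_zero]
    intro γ hγ
    obtain ⟨δ, hδ, h⟩ := hequi γ hγ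
    filter_upwards [self_mem_nhdsWithin, hx (Metric.ball_mem_nhds x₀ hδ)] with ε hε hxε
    exact h (x ε) (hxΩ ε hε) (mem_ball_iff_norm.1 hxε) (τ ε) (hτ ε hε).1
  simpa using hdiff.add (hlim.comp hτlim)

/-- If a c-bounded, locally equi-continuous net `(F_ε)` converges pointwise on `Ω₁`
to a continuous map `G : Ω₁ → Ω₂`, then the generalized graph coincides with the
classical graph of `G`: `C_F = {(x, G x) : x ∈ Ω₁}`. -/
theorem genGraph_eq_graph_of_pointwise_limit {n m : ℕ}
    (Ω₁ : Set (EuclideanSpace ℝ (Fin n))) (Ω₂ : Set (EuclideanSpace ℝ (Fin m)))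
    (hΩ₁ : IsOpen Ω₁) (hΩ₂ : IsOpen Ω₂)
    (Fnet : ℝ → EuclideanSpace ℝ (Fin n) → EuclideanSpace ℝ (Fin m))
    (hcont : ∀ ε ∈ Set.Ioc (0:ℝ) 1, ContinuousOn (Fnet ε) Ω₁)
    (hcb : CBounded Fnet Ω₁ Ω₂)
    (hequi : ∀ x₀ ∈ Ω₁, EquiContAt Fnet Ω₁ x₀)
    (G : EuclideanSpace ℝ (Fin n) → EuclideanSpace ℝ (Fin m))
    (hG : ContinuousOn G Ω₁) (hGmaps : ∀ x ∈ Ω₁, G x ∈ Ω₂)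
    (hlim : ∀ x ∈ Ω₁, Filter.Tendsto (fun ε => Fnet ε x)
      (nhdsWithin 0 (Set.Ioc (0:ℝ) 1)) (nhds (G x))) :
    GenGraph Fnet Ω₁ Ω₂ = {p | p.1 ∈ Ω₁ ∧ p.2 = G p.1} := by
  have : (𝓝[Ioc (0 : ℝ) 1] (0 : ℝ)).NeBot := by
    rw [nhdsWithin_Ioc_eq_nhdsGT zero_lt_one]
    infer_instance
  ext ⟨x₀, y⟩
  constructor
  · rintro ⟨hx₀, -, x, τ, hxΩ, hτ, hx, hy⟩
    refine ⟨hx₀, ?_⟩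
    have hlim' := (hequi x₀ hx₀).tendsto_comp (hlim x₀ hx₀) hxΩ hτ hx
    have hcl : ClusterPt y (𝓝 (G x₀)) := (isClusterPtNet_iff_mapClusterPt.1 hy).clusterPt.mono hlim'
    exact eq_of_nhds_neBot hcl
  · rintro ⟨hx₀, hy⟩
    obtain rfl : y = G x₀ := hy
    exact ⟨hx₀, hGmaps x₀ hx₀, fun _ => x₀, id, fun _ _ => hx₀, fun _ hε => ⟨hε, le_rfl⟩,
      tendsto_const_nhds, isClusterPtNet_iff_mapClusterPt.2 (hlim x₀ hx₀).mapClusterPt⟩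
end

section
/- Let (F_ε)_{ε∈(0,1]} be a c-bounded net of maps from Ω₁ into Ω₂. Then the generalized graph C_F is a closed subset of Ω₁ × Ω₂ in the product topology. -/
open Set Filter Topology

/-- A point of `Ω₁ ×ˢ Ω₂` belongs to the generalized graph if and only if, for every
`δ ∈ (0,1]`, it lies in the closure of the union of the graphs of the maps `Fnet η`, `η ≤ δ`. -/
theorem genGraph_eq_inter_closure {E F : Type*} [PseudoMetricSpace E] [PseudoMetricSpace F]
    (Fnet : ℝ → E → F) (Ω₁ : Set E) (Ω₂ : Set F) :
    GenGraph Fnet Ω₁ Ω₂ = (Ω₁ ×ˢ Ω₂) ∩ ⋂ δ ∈ Set.Ioc (0:ℝ) 1,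
      closure {p : E × F | p.1 ∈ Ω₁ ∧ ∃ η ∈ Set.Ioc (0:ℝ) δ, p.2 = Fnet η p.1} := by
  ext ⟨x, y⟩
  constructor
  · rintro ⟨hx, hy, u, τ, hu, hτ, hlim, hcl⟩
    refine ⟨⟨hx, hy⟩, mem_iInter₂.2 fun δ hδ => Metric.mem_closure_iff.2 fun r hr => ?_⟩
    obtain ⟨d, hd, hud⟩ := Metric.tendsto_nhdsWithin_nhds.1 hlim r hr
    obtain ⟨ε, hε, hεlt, hεy⟩ := hcl _ (Metric.ball_mem_nhds y hr) (min d δ)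
      ⟨lt_min hd hδ.1, (min_le_right d δ).trans hδ.2⟩
    have hεδ : ε < δ := hεlt.trans_le (min_le_right _ _)
    have hε1 : ε ∈ Set.Ioc (0:ℝ) 1 := ⟨hε, hεδ.le.trans hδ.2⟩
    refine ⟨(u ε, Fnet (τ ε) (u ε)), ⟨hu ε hε1, τ ε,
      ⟨(hτ ε hε1).1.1, (hτ ε hε1).2.trans hεδ.le⟩, rfl⟩, ?_⟩
    have hux : dist (u ε) x < r := hud hε1 (by
      rw [Real.dist_eq, sub_zero, abs_of_pos hε]
      exact hεlt.trans_le (min_le_left _ _))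
    rw [dist_comm, Prod.dist_eq]
    exact max_lt hux hεy
  · rintro ⟨⟨hx, hy⟩, hcl⟩
    have happrox : ∀ ε : ℝ, ∃ (u : E) (η : ℝ), ε ∈ Set.Ioc (0:ℝ) 1 →
        u ∈ Ω₁ ∧ η ∈ Set.Ioc (0:ℝ) ε ∧ dist u x < ε ∧ dist (Fnet η u) y < ε := by
      intro ε
      by_cases hε : ε ∈ Set.Ioc (0:ℝ) 1
      · obtain ⟨⟨u, v⟩, ⟨hu, η, hη, hv⟩, hd⟩ :=
          Metric.mem_closure_iff.1 (mem_iInter₂.1 hcl ε hε) ε hε.1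
        dsimp only at hu hv
        subst hv
        rw [dist_comm, Prod.dist_eq, max_lt_iff] at hd
        exact ⟨u, η, fun _ => ⟨hu, hη, hd⟩⟩
      · exact ⟨x, ε, fun h => absurd h hε⟩
    choose u τ huτ using happrox
    refine ⟨hx, hy, u, τ, fun ε hε => (huτ ε hε).1, fun ε hε => ?_, ?_, ?_⟩
    · obtain ⟨-, hτ, -⟩ := huτ ε hε
      exact ⟨⟨hτ.1, hτ.2.trans hε.2⟩, hτ.2⟩
    · refine Metric.tendsto_nhdsWithin_nhds.2 fun r hr => ⟨r, hr, fun {ε} hε hεr => ?_⟩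
      rw [Real.dist_eq, sub_zero, abs_of_pos hε.1] at hεr
      exact (huτ ε hε).2.2.1.trans hεr
    · intro U hU ε₀ hε₀
      obtain ⟨r, hr, hrU⟩ := Metric.mem_nhds_iff.1 hU
      obtain ⟨ε, hε, hεlt⟩ := exists_between (lt_min hr hε₀.1)
      have hεε₀ : ε < ε₀ := hεlt.trans_le (min_le_right _ _)
      exact ⟨ε, hε, hεε₀, hrU ((huτ ε ⟨hε, hεε₀.le.trans hε₀.2⟩).2.2.2.trans
        (hεlt.trans_le (min_le_left _ _)))⟩

/-- The generalized graph `C_F` of a c-bounded net of (continuous) maps is a closed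
subset of `Ω₁ × Ω₂` in the product topology; since `Ω₁ ×ˢ Ω₂` is open in the ambient
product space, this is equivalent to `(Ω₁ ×ˢ Ω₂) \ C_F` being open. -/
theorem genGraph_closed {n m : ℕ}
    (Ω₁ : Set (EuclideanSpace ℝ (Fin n))) (Ω₂ : Set (EuclideanSpace ℝ (Fin m)))
    (hΩ₁ : IsOpen Ω₁) (hΩ₂ : IsOpen Ω₂)
    (Fnet : ℝ → EuclideanSpace ℝ (Fin n) → EuclideanSpace ℝ (Fin m))
    (hcont : ∀ ε ∈ Set.Ioc (0:ℝ) 1, ContinuousOn (Fnet ε) Ω₁)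
    (hcb : CBounded Fnet Ω₁ Ω₂) :
    IsOpen ((Ω₁ ×ˢ Ω₂) \ GenGraph Fnet Ω₁ Ω₂) := by
  rw [genGraph_eq_inter_closure, sdiff_self_inter]
  exact (hΩ₁.prod hΩ₂).sdiff (isClosed_biInter fun _ _ => isClosed_closure)
end

section
/- Let (F_ε)_{ε∈(0,1]} be a c-bounded net of maps from Ω₁ into Ω₂, let X₀ ⊆ Ω₁ be compact, and set Y₀ := π₂(C_F ∩ (X₀ × Ω₂)), where π₂(x,y) = y. If Y ⊆ Ω₂ is a neighborhood of Y₀, then there exist a neighborhood X ⊆ Ω₁ of X₀ and ε' > 0 such that F_ε(X) ⊆ Y for all ε < ε'. -/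
open Set Filter Topology

/-- A point `(x₀, y) ∈ Ω₁ × Ω₂` such that `y` is a cluster point of `Fnet ε x` as `x → x₀` and
`ε → 0` belongs to the generalized graph. -/
theorem mem_genGraph_of_mapClusterPt {E F : Type*} [PseudoMetricSpace E] [PseudoMetricSpace F]
    {Fnet : ℝ → E → F} {Ω₁ : Set E} {Ω₂ : Set F} (hΩ₁ : IsOpen Ω₁) {x₀ : E} {y : F}
    (hx₀ : x₀ ∈ Ω₁) (hy : y ∈ Ω₂)
    (h : MapClusterPt y (𝓝[Ioc (0:ℝ) 1] 0 ×ˢ 𝓝 x₀) (Function.uncurry Fnet)) :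
    (x₀, y) ∈ GenGraph Fnet Ω₁ Ω₂ := by
  have key : ∀ ε : ℝ, ∃ p : ℝ × E, ε ∈ Ioc (0:ℝ) 1 →
      p.1 ∈ Ioc (0:ℝ) 1 ∧ p.1 ≤ ε ∧ p.2 ∈ Ω₁ ∧ dist p.2 x₀ < ε ∧ dist (Fnet p.1 p.2) y < ε := by
    intro ε
    by_cases hε : ε ∈ Ioc (0:ℝ) 1
    · have h1 : ∀ᶠ t in 𝓝[Ioc (0:ℝ) 1] 0, t ∈ Ioc (0:ℝ) 1 ∧ t ≤ ε :=
        eventually_mem_nhdsWithin.and (mem_nhdsWithin_of_mem_nhds (Iic_mem_nhds hε.1))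
      have h2 : ∀ᶠ x in 𝓝 x₀, x ∈ Ω₁ ∧ dist x x₀ < ε :=
        Filter.Eventually.and (hΩ₁.mem_nhds hx₀) (Metric.ball_mem_nhds x₀ hε.1)
      obtain ⟨p, hp, ⟨ht, htε⟩, hxΩ, hx⟩ :=
        ((h.frequently (Metric.ball_mem_nhds y hε.1)).and_eventually (h1.prod_mk h2)).exists
      exact ⟨p, fun _ => ⟨ht, htε, hxΩ, hx, hp⟩⟩
    · exact ⟨(0, x₀), fun h => absurd h hε⟩
  choose p hp using key
  refine ⟨hx₀, hy, fun ε => (p ε).2, fun ε => (p ε).1, fun ε hε => (hp ε hε).2.2.1,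
    fun ε hε => ⟨(hp ε hε).1, (hp ε hε).2.1⟩, ?_, fun U hU ε₀ hε₀ => ?_⟩
  · refine tendsto_iff_dist_tendsto_zero.2 (squeeze_zero' (.of_forall fun _ => dist_nonneg) ?_
      (tendsto_id.mono_left nhdsWithin_le_nhds))
    filter_upwards [self_mem_nhdsWithin] with ε hε using (hp ε hε).2.2.2.1.le
  · obtain ⟨r, hr, hrU⟩ := Metric.mem_nhds_iff.1 hU
    obtain ⟨ε, hε, hlt⟩ := exists_between (lt_min hr hε₀.1)
    have hε1 : ε ∈ Ioc (0:ℝ) 1 := ⟨hε, (hlt.le.trans (min_le_right _ _)).trans hε₀.2⟩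
    exact ⟨ε, hε, hlt.trans_le (min_le_right _ _),
      hrU ((hp ε hε1).2.2.2.2.trans_le (hlt.le.trans (min_le_left _ _)))⟩

/-- If `Y` is a neighborhood of the fibre of the generalized graph over `x₀ ∈ Ω₁`, then
`Fnet ε x ∈ Y` for all `x` near `x₀` and all small `ε`. -/
theorem CBounded.eventually_mem_of_genGraph_fibre {E F : Type*} [PseudoMetricSpace E]
    [LocallyCompactSpace E] [PseudoMetricSpace F] {Fnet : ℝ → E → F} {Ω₁ : Set E} {Ω₂ : Set F}
    (hcb : CBounded Fnet Ω₁ Ω₂) (hΩ₁ : IsOpen Ω₁) {x₀ : E} (hx₀ : x₀ ∈ Ω₁) {Y : Set F}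
    (hY : ∀ y, (x₀, y) ∈ GenGraph Fnet Ω₁ Ω₂ → Y ∈ 𝓝 y) :
    ∀ᶠ p in 𝓝[Ioc (0:ℝ) 1] 0 ×ˢ 𝓝 x₀, Function.uncurry Fnet p ∈ Y := by
  obtain ⟨K, hK, hKΩ, hKc⟩ := local_compact_nhds (hΩ₁.mem_nhds hx₀)
  obtain ⟨K', hK'Ω, hK'c, ε₀, hε₀, hF⟩ := hcb K hKΩ hKc
  have hmem : ∀ᶠ p in 𝓝[Ioc (0:ℝ) 1] 0 ×ˢ 𝓝 x₀, Function.uncurry Fnet p ∈ K' := by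
    have h1 : ∀ᶠ t in 𝓝[Ioc (0:ℝ) 1] 0, t ∈ Ioc (0:ℝ) 1 ∧ t ≤ ε₀ :=
      eventually_mem_nhdsWithin.and (mem_nhdsWithin_of_mem_nhds (Iic_mem_nhds hε₀))
    filter_upwards [h1.prod_mk hK] with p hp
    exact hF p.1 hp.1.1 hp.1.2 (mem_image_of_mem _ hp.2)
  by_contra hnot
  have hfreq : ∃ᶠ p in 𝓝[Ioc (0:ℝ) 1] 0 ×ˢ 𝓝 x₀, Function.uncurry Fnet p ∈ K' \ Y :=
    ((not_eventually.1 hnot).and_eventually hmem).mono fun _ h => ⟨h.2, h.1⟩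
  have : NeBot ((𝓝[Ioc (0:ℝ) 1] 0 ×ˢ 𝓝 x₀) ⊓ 𝓟 {p | Function.uncurry Fnet p ∈ K' \ Y}) :=
    frequently_mem_iff_neBot.1 hfreq
  have hev : ∀ᶠ p in (𝓝[Ioc (0:ℝ) 1] 0 ×ˢ 𝓝 x₀) ⊓ 𝓟 {p | Function.uncurry Fnet p ∈ K' \ Y},
      Function.uncurry Fnet p ∈ K' \ Y := mem_inf_of_right (mem_principal_self _)
  obtain ⟨y, hyK, hy⟩ := hK'c.exists_mapClusterPt_of_frequently
    (hev.mono fun _ h => h.1).frequently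
  have hyY := hY y (mem_genGraph_of_mapClusterPt hΩ₁ hx₀ (hK'Ω hyK) (hy.mono inf_le_left))
  obtain ⟨p, hpY, hp⟩ := ((hy.frequently hyY).and_eventually hev).exists
  exact hp.2 hpY

/-- If `X₀ ⊆ Ω₁` is compact, `Y₀ := π₂(C_F ∩ (X₀ × Ω₂))` and `Y ⊆ Ω₂` is a
neighborhood of `Y₀`, then there is a neighborhood `X ⊆ Ω₁` of `X₀` and `ε' > 0`
such that `F_ε(X) ⊆ Y` for all `ε < ε'`. -/
theorem image_subset_of_nbhd_of_genGraph_image {n m : ℕ}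
    (Ω₁ : Set (EuclideanSpace ℝ (Fin n))) (Ω₂ : Set (EuclideanSpace ℝ (Fin m)))
    (hΩ₁ : IsOpen Ω₁) (hΩ₂ : IsOpen Ω₂)
    (Fnet : ℝ → EuclideanSpace ℝ (Fin n) → EuclideanSpace ℝ (Fin m))
    (hcont : ∀ ε ∈ Set.Ioc (0:ℝ) 1, ContinuousOn (Fnet ε) Ω₁)
    (hcb : CBounded Fnet Ω₁ Ω₂)
    (X₀ : Set (EuclideanSpace ℝ (Fin n))) (hX₀ : IsCompact X₀) (hX₀Ω : X₀ ⊆ Ω₁)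
    (Y : Set (EuclideanSpace ℝ (Fin m))) (hYΩ : Y ⊆ Ω₂)
    (hYnb : Y ∈ nhdsSet (Prod.snd ''
      (GenGraph Fnet Ω₁ Ω₂ ∩ X₀ ×ˢ (Set.univ : Set (EuclideanSpace ℝ (Fin m)))))) :
    ∃ X ⊆ Ω₁, X ∈ nhdsSet X₀ ∧ ∃ ε' > (0:ℝ),
      ∀ ε ∈ Set.Ioc (0:ℝ) 1, ε < ε' → Fnet ε '' X ⊆ Y := by
  have hloc : ∀ x ∈ X₀, {p | Function.uncurry Fnet p ∈ Y} ∈ 𝓝[Ioc (0:ℝ) 1] 0 ×ˢ 𝓝 x :=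
    fun x hx => hcb.eventually_mem_of_genGraph_fibre hΩ₁ (hX₀Ω hx) fun y hy =>
      mem_nhdsSet_iff_forall.1 hYnb y ⟨(x, y), ⟨hy, hx, mem_univ y⟩, rfl⟩
  obtain ⟨T, hT, X, hX, hTX⟩ := mem_prod_iff.1 (hX₀.mem_prod_nhdsSet_of_forall hloc)
  obtain ⟨ε', hε', hball⟩ := Metric.mem_nhdsWithin_iff.1 hT
  refine ⟨X ∩ Ω₁, inter_subset_right, inter_mem hX (hΩ₁.mem_nhdsSet.2 hX₀Ω), ε', hε', ?_⟩
  rintro ε hε hlt _ ⟨x, hx, rfl⟩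
  refine hTX (mk_mem_prod (hball ⟨?_, hε⟩) hx.1)
  simpa [abs_of_pos hε.1] using hlt
end

section
/- Let (F_ε)_{ε∈(0,1]} be a c-bounded net of maps from Ω₁ into Ω₂, let X₀ ⊆ Ω₁ be compact, and set Y₀ := π₂(C_F ∩ (X₀ × Ω₂)), where π₂(x,y) = y. If Y ⊆ Ω₂ is a neighborhood of Y₀, then there exists a neighborhood X ⊆ Ω₁ of X₀ such that C_F ∩ (X × Ω₂) ⊆ X × Y. -/
open Set Filter Topology

/-- The filter generated by the tails `{(x, Fnet ε x) | x ∈ Ω₁, ε < ε₀}` of the graphs. -/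
def graphTail {E F : Type*} (Fnet : ℝ → E → F) (Ω₁ : Set E) : Filter (E × F) :=
  map (fun q : ℝ × E => (q.2, Fnet q.1 q.2)) (𝓝[Set.Ioc (0:ℝ) 1] 0 ×ˢ 𝓟 Ω₁)

theorem image_mem_graphTail {E F : Type*} (Fnet : ℝ → E → F) (Ω₁ : Set E) {ε₀ : ℝ}
    (hε₀ : 0 < ε₀) :
    {p : E × F | ∃ ε ∈ Set.Ioc (0:ℝ) 1, ε < ε₀ ∧ p.1 ∈ Ω₁ ∧ Fnet ε p.1 = p.2} ∈
      graphTail Fnet Ω₁ := by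
  have h : Set.Iio ε₀ ∩ Set.Ioc (0:ℝ) 1 ∈ 𝓝[Set.Ioc (0:ℝ) 1] (0:ℝ) :=
    inter_mem (mem_nhdsWithin_of_mem_nhds (Iio_mem_nhds hε₀)) self_mem_nhdsWithin
  exact mem_map.2 (mem_of_superset (prod_mem_prod h (mem_principal_self Ω₁))
    fun q hq => ⟨q.1, hq.1.2, hq.1.1, hq.2, rfl⟩)

/-- Inside `Ω₁ ×ˢ Ω₂`, the generalized graph is the set of cluster points of `graphTail`. -/
theorem mem_genGraph_iff {E F : Type*} [PseudoMetricSpace E] [PseudoMetricSpace F]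
    {Fnet : ℝ → E → F} {Ω₁ : Set E} {Ω₂ : Set F} {p : E × F} :
    p ∈ GenGraph Fnet Ω₁ Ω₂ ↔ p.1 ∈ Ω₁ ∧ p.2 ∈ Ω₂ ∧ ClusterPt p (graphTail Fnet Ω₁) := by
  refine and_congr_right fun _ => and_congr_right fun _ => ⟨?_, fun h => ?_⟩
  · rintro ⟨x, τ, hxΩ, hτ, hx, hcl⟩
    rw [clusterPt_iff_nonempty]
    intro s hs t ht
    obtain ⟨U, hU, V, hV, hUV⟩ := mem_nhds_prod_iff.1 hs
    obtain ⟨A, hA, B, hB, hAB⟩ := mem_prod_iff.1 (mem_map.1 ht)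
    obtain ⟨δ, hδ, hδA⟩ := Metric.mem_nhdsWithin_iff.1 hA
    obtain ⟨η, hη, hηU⟩ := Metric.mem_nhdsWithin_iff.1 (hx hU)
    obtain ⟨ε, hε, hlt, hV'⟩ := hcl V hV (min 1 (min δ η))
      ⟨lt_min one_pos (lt_min hδ hη), min_le_left _ _⟩
    obtain ⟨h1, hlt⟩ := lt_min_iff.1 hlt
    obtain ⟨h2, h3⟩ := lt_min_iff.1 hlt
    have hεI : ε ∈ Set.Ioc (0:ℝ) 1 := ⟨hε, h1.le⟩
    obtain ⟨hτI, hτε⟩ := hτ ε hεI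
    refine ⟨(x ε, Fnet (τ ε) (x ε)), hUV ⟨hηU ⟨?_, hεI⟩, hV'⟩,
      hAB (a := (τ ε, x ε)) ⟨hδA ⟨?_, hτI⟩, hB (hxΩ ε hεI)⟩⟩
    · rwa [Metric.mem_ball, Real.dist_0_eq_abs, abs_of_pos hε]
    · rw [Metric.mem_ball, Real.dist_0_eq_abs, abs_of_pos hτI.1]
      exact hτε.trans_lt h2
  · have key : ∀ ε : ℝ, ∃ q : E × ℝ, 0 < ε → q.1 ∈ Ω₁ ∧ q.2 ∈ Set.Ioc (0:ℝ) 1 ∧ q.2 ≤ ε ∧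
        dist q.1 p.1 < ε ∧ dist (Fnet q.2 q.1) p.2 < ε := by
      intro ε
      by_cases hε : 0 < ε
      · obtain ⟨⟨a, b⟩, hab, t, ht, htε, haΩ, hb⟩ := clusterPt_iff_nonempty.1 h
          (Metric.ball_mem_nhds p hε) (image_mem_graphTail Fnet Ω₁ hε)
        rw [Metric.mem_ball, Prod.dist_eq, max_lt_iff] at hab
        exact ⟨(a, t), fun _ => ⟨haΩ, ht, htε.le, hab.1, hb ▸ hab.2⟩⟩
      · exact ⟨(p.1, 0), fun h0 => absurd h0 hε⟩
    choose q hq using key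
    refine ⟨fun ε => (q ε).1, fun ε => (q ε).2, fun ε hε => (hq ε hε.1).1,
      fun ε hε => ⟨(hq ε hε.1).2.1, (hq ε hε.1).2.2.1⟩, ?_, ?_⟩
    · rw [tendsto_iff_dist_tendsto_zero]
      refine squeeze_zero' (Eventually.of_forall fun _ => dist_nonneg) ?_
        (tendsto_id.mono_left nhdsWithin_le_nhds)
      filter_upwards [self_mem_nhdsWithin] with ε hε using (hq ε hε.1).2.2.2.1.le
    · intro U hU ε₀ hε₀
      obtain ⟨r, hr, hrU⟩ := Metric.mem_nhds_iff.1 hU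
      obtain ⟨ε, hε, hlt⟩ := exists_between (lt_min hε₀.1 hr)
      obtain ⟨h1, h2⟩ := lt_min_iff.1 hlt
      exact ⟨ε, hε, h1, hrU ((hq ε hε).2.2.2.2.trans h2)⟩

/-- The generalized graph meets a compact box in `Ω₁ ×ˢ Ω₂` in a compact set. -/
theorem isCompact_genGraph_inter_prod {E F : Type*} [PseudoMetricSpace E] [PseudoMetricSpace F]
    {Fnet : ℝ → E → F} {Ω₁ K : Set E} {Ω₂ L : Set F}
    (hK : IsCompact K) (hKΩ : K ⊆ Ω₁) (hL : IsCompact L) (hLΩ : L ⊆ Ω₂) :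
    IsCompact (GenGraph Fnet Ω₁ Ω₂ ∩ K ×ˢ L) := by
  have heq : GenGraph Fnet Ω₁ Ω₂ ∩ K ×ˢ L =
      K ×ˢ L ∩ {p | ClusterPt p (graphTail Fnet Ω₁)} := by
    ext p
    rw [mem_inter_iff, mem_genGraph_iff]
    exact ⟨fun h => ⟨h.2, h.1.2.2⟩, fun h => ⟨⟨hKΩ h.1.1, hLΩ h.1.2, h.2⟩, h.1⟩⟩
  rw [heq]
  exact (hK.prod hL).inter_right isClosed_setOfPred_clusterPt

/-- If the maps eventually send `K` into a closed set `L`, then the fibres of the generalized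
graph over interior points of `K` lie in `L`. -/
theorem snd_mem_of_mem_genGraph {E F : Type*} [PseudoMetricSpace E] [PseudoMetricSpace F]
    {Fnet : ℝ → E → F} {Ω₁ K : Set E} {Ω₂ L : Set F} {ε₀ : ℝ} (hε₀ : 0 < ε₀)
    (hL : IsClosed L) (hKL : ∀ ε ∈ Set.Ioc (0:ℝ) 1, ε ≤ ε₀ → Fnet ε '' K ⊆ L)
    {p : E × F} (hp : p ∈ GenGraph Fnet Ω₁ Ω₂) (hpK : p.1 ∈ interior K) : p.2 ∈ L := by
  by_contra hpL
  obtain ⟨q, hq, ε, hε, hεlt, -, hqε⟩ := clusterPt_iff_nonempty.1 (mem_genGraph_iff.1 hp).2.2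
    ((isOpen_interior.prod hL.isOpen_compl).mem_nhds ⟨hpK, hpL⟩)
    (image_mem_graphTail Fnet Ω₁ hε₀)
  exact hq.2 (hqε ▸ hKL ε hε hεlt.le (mem_image_of_mem _ (interior_subset hq.1)))

/-- If `X₀ ⊆ Ω₁` is compact, `Y₀ := π₂(C_F ∩ (X₀ × Ω₂))` and `Y ⊆ Ω₂` is a
neighborhood of `Y₀`, then there is a neighborhood `X ⊆ Ω₁` of `X₀` with
`C_F ∩ (X × Ω₂) ⊆ X × Y`. -/
theorem genGraph_localization {n m : ℕ}
    (Ω₁ : Set (EuclideanSpace ℝ (Fin n))) (Ω₂ : Set (EuclideanSpace ℝ (Fin m)))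
    (hΩ₁ : IsOpen Ω₁) (hΩ₂ : IsOpen Ω₂)
    (Fnet : ℝ → EuclideanSpace ℝ (Fin n) → EuclideanSpace ℝ (Fin m))
    (hcont : ∀ ε ∈ Set.Ioc (0:ℝ) 1, ContinuousOn (Fnet ε) Ω₁)
    (hcb : CBounded Fnet Ω₁ Ω₂)
    (X₀ : Set (EuclideanSpace ℝ (Fin n))) (hX₀ : IsCompact X₀) (hX₀Ω : X₀ ⊆ Ω₁)
    (Y : Set (EuclideanSpace ℝ (Fin m))) (hYΩ : Y ⊆ Ω₂)
    (hYnb : Y ∈ nhdsSet (Prod.snd ''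
      (GenGraph Fnet Ω₁ Ω₂ ∩ X₀ ×ˢ (Set.univ : Set (EuclideanSpace ℝ (Fin m)))))) :
    ∃ X ⊆ Ω₁, X ∈ nhdsSet X₀ ∧
      GenGraph Fnet Ω₁ Ω₂ ∩ X ×ˢ (Set.univ : Set (EuclideanSpace ℝ (Fin m))) ⊆ X ×ˢ Y := by
  obtain ⟨K, hK, hX₀K, hKΩ⟩ := exists_compact_between hX₀ hΩ₁ hX₀Ω
  obtain ⟨L, hLΩ, hL, ε₀, hε₀, hKL⟩ := hcb K hKΩ hK
  set B := Prod.fst '' (GenGraph Fnet Ω₁ Ω₂ ∩ K ×ˢ (L \ interior Y))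
  have hBclosed : IsClosed B :=
    ((isCompact_genGraph_inter_prod hK hKΩ (hL.diff isOpen_interior)
      (sdiff_subset.trans hLΩ)).image continuous_fst).isClosed
  refine ⟨interior K \ B, sdiff_subset.trans (interior_subset.trans hKΩ), ?_, ?_⟩
  · refine (isOpen_interior.sdiff hBclosed).mem_nhdsSet.2 fun x hx => ⟨hX₀K hx, ?_⟩
    rintro ⟨p, ⟨hp, -, -, hpY⟩, rfl⟩
    exact hpY (subset_interior_iff_mem_nhdsSet.2 hYnb
      (mem_image_of_mem _ ⟨hp, hx, mem_univ _⟩))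
  · rintro p ⟨hp, hpX, -⟩
    refine ⟨hpX, by_contra fun hpY => hpX.2 ⟨p, ⟨hp, interior_subset hpX.1, ?_, ?_⟩, rfl⟩⟩
    · exact snd_mem_of_mem_genGraph hε₀ hL.isClosed hKL hp hpX.1
    · exact fun h => hpY (interior_subset h)
end

section
/- Let (f_ε)_{ε∈(0,1]} be a c-bounded net of smooth maps from Ω₁ into Ω₂ and let Γ ⊆ Ω₂ × S^{m−1} be closed. Then the wave-front unfavorable support U_f(Γ) := {x ∈ Ω₁ : ∃ y ∈ Ω₂, ∃ η ∈ S^{m−1} with (x,y) ∈ C_f, (x,η) ∉ D_f and (y,η) ∈ Γ} is a closed subset of Ω₁. -/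
open Set Filter Topology

open scoped RealInnerProductSpace

/-- The transposed Jacobian `ᵀdf(x) : ℝᵐ → ℝⁿ` of `f : ℝⁿ → ℝᵐ` at `x`, i.e. the
(Hilbert-space) adjoint of the Fréchet derivative. -/
noncomputable def tJac {n m : ℕ}
    (f : EuclideanSpace ℝ (Fin n) → EuclideanSpace ℝ (Fin m))
    (x : EuclideanSpace ℝ (Fin n)) :
    EuclideanSpace ℝ (Fin m) →L[ℝ] EuclideanSpace ℝ (Fin n) :=
  ContinuousLinearMap.adjoint (fderiv ℝ f x)

/-- A net `(σ ε)_{ε∈(0,1]}` of reals is of slow scale. -/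
def SlowScale (σ : ℝ → ℝ) : Prop :=
  ∃ ε' ∈ Set.Ioc (0:ℝ) 1, ∀ t ≥ (0:ℝ), ∃ C > (0:ℝ),
    ∀ ε ∈ Set.Ioc (0:ℝ) 1, ε < ε' → |σ ε| ^ t ≤ C * ε⁻¹

/-- `V^⊥ := {η ∈ S^{m-1} : ∃ η₀ ∈ V, ⟨η, η₀⟩ = 0}`. -/
def Vperp {m : ℕ} (V : Set (EuclideanSpace ℝ (Fin m))) :
    Set (EuclideanSpace ℝ (Fin m)) :=
  {η | η ∈ Metric.sphere (0 : EuclideanSpace ℝ (Fin m)) 1 ∧ ∃ η₀ ∈ V, ⟪η, η₀⟫ = 0}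

/-- The open set `D_f ⊆ Ω₁ × S^{m-1}` of pairs `(x,η)` admitting a neighborhood
`X × V` and a positive slow-scale net `(σ ε)` with
`inf_{X×V} |σ_ε ᵀdf_ε η'| ≥ 1` and `sup_{X×V^⊥} |σ_ε ᵀdf_ε η'| ≤ 1` for small `ε`. -/
def Dset {n m : ℕ}
    (f : ℝ → EuclideanSpace ℝ (Fin n) → EuclideanSpace ℝ (Fin m))
    (Ω₁ : Set (EuclideanSpace ℝ (Fin n))) :
    Set (EuclideanSpace ℝ (Fin n) × EuclideanSpace ℝ (Fin m)) :=
  {p | p.1 ∈ Ω₁ ∧ p.2 ∈ Metric.sphere (0 : EuclideanSpace ℝ (Fin m)) 1 ∧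
    ∃ X V, X ⊆ Ω₁ ∧ V ⊆ Metric.sphere (0 : EuclideanSpace ℝ (Fin m)) 1 ∧
      X ∈ nhds p.1 ∧ V ∈ nhdsWithin p.2 (Metric.sphere (0 : EuclideanSpace ℝ (Fin m)) 1) ∧
      ∃ σ : ℝ → ℝ, (∀ ε ∈ Set.Ioc (0:ℝ) 1, 0 < σ ε) ∧ SlowScale σ ∧
        ∃ ε' ∈ Set.Ioc (0:ℝ) 1, ∀ ε ∈ Set.Ioc (0:ℝ) 1, ε < ε' →
          (∀ x' ∈ X, ∀ η' ∈ V, 1 ≤ ‖σ ε • tJac (f ε) x' η'‖) ∧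
          (∀ x' ∈ X, ∀ η' ∈ Vperp V, ‖σ ε • tJac (f ε) x' η'‖ ≤ 1)}

/-- Pairs in the generalized graph are the points of `Ω₁ × Ω₂` that are approximated by points
of the graphs of `Fnet ε` with arbitrarily small `ε`. -/
theorem mem_genGraph_iff_s10 {E F : Type*} [PseudoMetricSpace E] [PseudoMetricSpace F]
    {Fnet : ℝ → E → F} {Ω₁ : Set E} {Ω₂ : Set F} {x : E} {y : F} :
    (x, y) ∈ GenGraph Fnet Ω₁ Ω₂ ↔ x ∈ Ω₁ ∧ y ∈ Ω₂ ∧ ∀ r > (0:ℝ), ∃ ε ∈ Set.Ioc (0:ℝ) 1,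
      ε < r ∧ ∃ x' ∈ Ω₁, dist x' x < r ∧ dist (Fnet ε x') y < r := by
  constructor
  · rintro ⟨hx, hy, u, τ, hu, hτ, hlim, hcl⟩
    refine ⟨hx, hy, fun r hr => ?_⟩
    have hev : ∀ᶠ ε in 𝓝[Set.Ioc (0:ℝ) 1] 0, dist (u ε) x < r :=
      hlim.eventually (Metric.ball_mem_nhds x hr)
    obtain ⟨δ, hδ, hball⟩ := Metric.mem_nhdsWithin_iff.1 hev
    obtain ⟨ε, hε, hεlt, hmem⟩ := hcl (Metric.ball y r) (Metric.ball_mem_nhds y hr)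
      (min 1 (min r δ)) ⟨by positivity, min_le_left _ _⟩
    simp only [lt_min_iff] at hεlt
    have hI : ε ∈ Set.Ioc (0:ℝ) 1 := ⟨hε, hεlt.1.le⟩
    refine ⟨τ ε, (hτ ε hI).1, (hτ ε hI).2.trans_lt hεlt.2.1, u ε, hu ε hI,
      hball ⟨?_, hI⟩, hmem⟩
    simpa [Real.dist_eq, abs_of_pos hε] using hεlt.2.2
  · rintro ⟨hx, hy, h⟩
    have h' : ∀ r : ℝ, ∃ ε x', 0 < r → ε ∈ Set.Ioc (0:ℝ) 1 ∧ ε < r ∧ x' ∈ Ω₁ ∧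
        dist x' x < r ∧ dist (Fnet ε x') y < r := by
      intro r
      by_cases hr : 0 < r
      · obtain ⟨ε, hε, hεr, x', hx'⟩ := h r hr
        exact ⟨ε, x', fun _ => ⟨hε, hεr, hx'⟩⟩
      · exact ⟨0, x, fun h => absurd h hr⟩
    choose τ u hu using h'
    refine ⟨hx, hy, u, τ, fun ε hε => (hu ε hε.1).2.2.1,
      fun ε hε => ⟨(hu ε hε.1).1, (hu ε hε.1).2.1.le⟩, ?_, ?_⟩
    · rw [Metric.tendsto_nhdsWithin_nhds]
      intro r hr
      refine ⟨r, hr, fun {ε} hε hεr => (hu ε hε.1).2.2.2.1.trans ?_⟩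
      simpa [Real.dist_eq, abs_of_pos hε.1] using hεr
    · intro U hU ε₀ hε₀
      obtain ⟨r, hr, hball⟩ := Metric.mem_nhds_iff.1 hU
      have hpos : 0 < min ε₀ r / 2 := half_pos (lt_min hε₀.1 hr)
      have hlt : min ε₀ r / 2 < min ε₀ r := half_lt_self (lt_min hε₀.1 hr)
      exact ⟨_, hpos, hlt.trans_le (min_le_left _ _),
        hball ((hu _ hpos).2.2.2.2.trans (hlt.trans_le (min_le_right _ _)))⟩

/-- The generalized graph is closed relative to `Ω₁ × Ω₂`. -/
theorem mem_genGraph_of_tendsto {E F : Type*} [PseudoMetricSpace E] [PseudoMetricSpace F]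
    {Fnet : ℝ → E → F} {Ω₁ : Set E} {Ω₂ : Set F} {x : E} {y : F} {u : ℕ → E} {v : ℕ → F}
    (hx : x ∈ Ω₁) (hy : y ∈ Ω₂) (hu : Tendsto u atTop (𝓝 x)) (hv : Tendsto v atTop (𝓝 y))
    (h : ∀ k, (u k, v k) ∈ GenGraph Fnet Ω₁ Ω₂) : (x, y) ∈ GenGraph Fnet Ω₁ Ω₂ := by
  refine mem_genGraph_iff_s10.2 ⟨hx, hy, fun r hr => ?_⟩
  obtain ⟨k, hk₁, hk₂⟩ := ((hu.eventually (Metric.ball_mem_nhds x (half_pos hr))).and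
    (hv.eventually (Metric.ball_mem_nhds y (half_pos hr)))).exists
  obtain ⟨ε, hε, hεr, x', hx', hd₁, hd₂⟩ := (mem_genGraph_iff_s10.1 (h k)).2.2 (r / 2) (half_pos hr)
  refine ⟨ε, hε, by linarith, x', hx', ?_, ?_⟩
  · linarith [dist_triangle x' (u k) x]
  · linarith [dist_triangle (Fnet ε x') (v k) y]

/-- If `Fnet ε` maps a neighborhood `K` of `x` into a closed set `K'` for all small `ε`, then
the fiber of the generalized graph over `x` lies in `K'`. -/
theorem mem_of_mem_genGraph {E F : Type*} [PseudoMetricSpace E] [PseudoMetricSpace F]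
    {Fnet : ℝ → E → F} {Ω₁ K : Set E} {Ω₂ K' : Set F} {x : E} {y : F} {ε₀ : ℝ} (hε₀ : 0 < ε₀)
    (hK : K ∈ 𝓝 x) (hK' : IsClosed K')
    (hmaps : ∀ ε ∈ Set.Ioc (0:ℝ) 1, ε ≤ ε₀ → Fnet ε '' K ⊆ K')
    (h : (x, y) ∈ GenGraph Fnet Ω₁ Ω₂) : y ∈ K' := by
  obtain ⟨δ, hδ, hball⟩ := Metric.mem_nhds_iff.1 hK
  rw [← hK'.closure_eq, Metric.mem_closure_iff]
  intro r hr
  obtain ⟨ε, hε, hεr, x', -, hd₁, hd₂⟩ :=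
    (mem_genGraph_iff_s10.1 h).2.2 (min r (min δ ε₀)) (by positivity)
  simp only [lt_min_iff] at hεr hd₁ hd₂
  exact ⟨Fnet ε x', hmaps ε hε hεr.2.2.le ⟨x', hball hd₁.2.1, rfl⟩, by
    rw [dist_comm]; exact hd₂.1⟩

/-- `Dset f Ω₁` is open relative to `Ω₁ × S^{m-1}`. -/
theorem eventually_mem_Dset {n m : ℕ}
    {f : ℝ → EuclideanSpace ℝ (Fin n) → EuclideanSpace ℝ (Fin m)}
    {Ω₁ : Set (EuclideanSpace ℝ (Fin n))}
    {p : EuclideanSpace ℝ (Fin n) × EuclideanSpace ℝ (Fin m)} (hp : p ∈ Dset f Ω₁) :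
    ∀ᶠ q in 𝓝 p, q.2 ∈ Metric.sphere (0 : EuclideanSpace ℝ (Fin m)) 1 → q ∈ Dset f Ω₁ := by
  obtain ⟨-, -, X, V, hXΩ, hVS, hX, hV, hσ⟩ := hp
  have hX' := continuous_fst.continuousAt.eventually (eventually_mem_nhds_iff.2 hX)
  have hV' := continuous_snd.continuousAt.eventually
    (eventually_nhdsWithin_iff.1 (eventually_eventually_nhdsWithin.2 hV))
  filter_upwards [hX', hV'] with q hq₁ hq₂ hqS
  exact ⟨hXΩ (mem_of_mem_nhds hq₁), hqS, X, V, hXΩ, hVS, hq₁, hq₂ hqS, hσ⟩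

/-- The wave-front unfavorable support
`U_f(Γ) := {x ∈ Ω₁ : ∃ y η, (x,y) ∈ C_f, (x,η) ∉ D_f, (y,η) ∈ Γ}`
of a c-bounded net of smooth maps `(f_ε)` w.r.t. a closed `Γ ⊆ Ω₂ × S^{m−1}` is a
closed subset of `Ω₁`; since `Ω₁` is open, this means `Ω₁ \ U_f(Γ)` is open. -/
theorem unfavorable_support_closed {n m : ℕ}
    (Ω₁ : Set (EuclideanSpace ℝ (Fin n))) (Ω₂ : Set (EuclideanSpace ℝ (Fin m)))
    (hΩ₁ : IsOpen Ω₁) (hΩ₂ : IsOpen Ω₂)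
    (f : ℝ → EuclideanSpace ℝ (Fin n) → EuclideanSpace ℝ (Fin m))
    (hsmooth : ∀ ε ∈ Set.Ioc (0:ℝ) 1, ContDiffOn ℝ (⊤ : ℕ∞) (f ε) Ω₁)
    (hcb : CBounded f Ω₁ Ω₂)
    (Γ : Set (EuclideanSpace ℝ (Fin m) × EuclideanSpace ℝ (Fin m)))
    (hΓsub : Γ ⊆ Ω₂ ×ˢ Metric.sphere (0 : EuclideanSpace ℝ (Fin m)) 1)
    (hΓclosed : ∃ C, IsClosed C ∧
      Γ = C ∩ Ω₂ ×ˢ Metric.sphere (0 : EuclideanSpace ℝ (Fin m)) 1) :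
    IsOpen (Ω₁ \ {x ∈ Ω₁ | ∃ y η, (x, y) ∈ GenGraph f Ω₁ Ω₂ ∧
      (x, η) ∉ Dset f Ω₁ ∧ (y, η) ∈ Γ}) := by
  obtain ⟨C, hC, rfl⟩ := hΓclosed
  set U := {x ∈ Ω₁ | ∃ y η, (x, y) ∈ GenGraph f Ω₁ Ω₂ ∧ (x, η) ∉ Dset f Ω₁ ∧
    (y, η) ∈ C ∩ Ω₂ ×ˢ Metric.sphere (0 : EuclideanSpace ℝ (Fin m)) 1}
  have hcl : ∀ x ∈ Ω₁, x ∈ closure U → x ∈ U := by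
    intro x hx hxU
    obtain ⟨K, hKx, hKΩ, hKc⟩ := local_compact_nhds (hΩ₁.mem_nhds hx)
    obtain ⟨K', hK'Ω, hK'c, ε₀, hε₀, hmaps⟩ := hcb K hKΩ hKc
    obtain ⟨u₀, hu₀U, hu₀⟩ := mem_closure_iff_seq_limit.1 hxU
    obtain ⟨N, hN⟩ := eventually_atTop.1 (hu₀.eventually (eventually_mem_nhds_iff.2 hKx))
    obtain ⟨u, hu, huU, huK⟩ : ∃ u : ℕ → EuclideanSpace ℝ (Fin n),
        Tendsto u atTop (𝓝 x) ∧ (∀ k, u k ∈ U) ∧ ∀ k, K ∈ 𝓝 (u k) :=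
      ⟨fun k => u₀ (k + N), (tendsto_add_atTop_iff_nat N).2 hu₀, fun k => hu₀U _,
        fun k => hN _ (Nat.le_add_left N k)⟩
    choose y η hG hD hΓ using fun k => (huU k).2
    obtain ⟨⟨y', η'⟩, hlimmem, φ, hφ, hlim⟩ :=
      (hK'c.prod (isCompact_sphere (0 : EuclideanSpace ℝ (Fin m)) 1)).tendsto_subseq
        (x := fun k => (y k, η k))
        (fun k => ⟨mem_of_mem_genGraph hε₀ (huK k) hK'c.isClosed hmaps (hG k), (hΓ k).2.2⟩)
    have huφ := hu.comp hφ.tendsto_atTop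
    refine ⟨hx, y', η', mem_genGraph_of_tendsto hx (hK'Ω hlimmem.1) huφ
      ((continuous_fst.tendsto _).comp hlim) (fun k => hG (φ k)), fun hmem => ?_,
      hC.mem_of_tendsto hlim (Eventually.of_forall fun k => (hΓ (φ k)).1),
      hK'Ω hlimmem.1, hlimmem.2⟩
    obtain ⟨k, hk⟩ := ((huφ.prodMk_nhds ((continuous_snd.tendsto _).comp hlim)).eventually
      (eventually_mem_Dset hmem)).exists
    exact hD (φ k) (hk (hΓ (φ k)).2.2)
  have hdiff : Ω₁ \ U = Ω₁ ∩ (closure U)ᶜ := by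
    ext x
    exact ⟨fun h => ⟨h.1, fun h' => h.2 (hcl x h.1 h')⟩,
      fun h => ⟨h.1, fun h' => h.2 (subset_closure h')⟩⟩
  rw [hdiff]
  exact hΩ₁.inter isClosed_closure.isOpen_compl
end

section
/- Let g be a twice continuously differentiable real-valued function on an open set containing the closed ball B̄_δ(x₀) ⊆ ℝⁿ (δ > 0), with g ≥ 0 on B̄_δ(x₀). Let v ∈ ℝⁿ be a unit vector and set m := max( sup_{x ∈ B̄_δ(x₀)} |∂_v² g(x)|, 2 g(x₀) δ^{−2} ), where ∂_v denotes the directional derivative in direction v. Then δ² |∂_v g(x₀)|² ≤ g(x₀) · ( g(x₀) + 2 δ² m ). -/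
open Set

theorem le_taylor_of_second_deriv_le {f f' f'' : ℝ → ℝ} {δ m : ℝ}
    (hf : ∀ t ∈ Icc 0 δ, HasDerivAt f (f' t) t)
    (hf' : ∀ t ∈ Icc 0 δ, HasDerivAt f' (f'' t) t)
    (hm : ∀ t ∈ Icc 0 δ, f'' t ≤ m) {s : ℝ} (hs : s ∈ Icc 0 δ) :
    f s ≤ f 0 + f' 0 * s + m * s ^ 2 / 2 := by
  have h1 : ∀ t ∈ Icc 0 δ, f' t ≤ f' 0 + m * t := by
    intro t ht
    refine image_le_of_deriv_right_le_deriv_boundary (f := f') (f' := f'') (a := 0) (b := δ)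
      (B := fun t => f' 0 + m * t) (B' := fun _ => m)
      (fun x hx => (hf' x hx).continuousAt.continuousWithinAt)
      (fun x hx => (hf' x (Ico_subset_Icc_self hx)).hasDerivWithinAt) (by simp)
      (by fun_prop) (fun x _ => ?_) (fun x hx => hm x (Ico_subset_Icc_self hx)) ht
    simpa using (((hasDerivAt_id x).const_mul m).const_add (f' 0)).hasDerivWithinAt
  refine image_le_of_deriv_right_le_deriv_boundary (f := f) (f' := f') (a := 0) (b := δ)
    (B := fun t => f 0 + f' 0 * t + m * t ^ 2 / 2) (B' := fun t => f' 0 + m * t)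
    (fun x hx => (hf x hx).continuousAt.continuousWithinAt)
    (fun x hx => (hf x (Ico_subset_Icc_self hx)).hasDerivWithinAt) (by simp)
    (by fun_prop) (fun x _ => ?_) (fun x hx => h1 x (Ico_subset_Icc_self hx)) hs
  have h := (((hasDerivAt_id x).const_mul (f' 0)).const_add (f 0)).add
    ((((hasDerivAt_id x).pow 2).const_mul m).div_const 2)
  refine (h.congr_deriv ?_).hasDerivWithinAt
  simp
  ring

theorem hasDerivAt_comp_add_smul {E : Type*} [NormedAddCommGroup E] [NormedSpace ℝ E]
    {g : E → ℝ} {x v : E} {ε t : ℝ} (hg : DifferentiableAt ℝ g (x + (ε * t) • v)) :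
    HasDerivAt (fun s : ℝ => g (x + (ε * s) • v)) (ε * fderiv ℝ g (x + (ε * t) • v) v) t := by
  have hline : HasDerivAt (fun s : ℝ => x + (ε * s) • v) (ε • v) t := by
    simpa using ((((hasDerivAt_id t).const_mul ε).smul_const v).const_add x)
  exact (hg.hasFDerivAt.comp_hasDerivAt t hline).congr_deriv (by simp)

/-- Let `g` be `C²` on an open set containing the closed ball `B̄_δ(x₀) ⊆ ℝⁿ`
(`δ > 0`), with `g ≥ 0` on `B̄_δ(x₀)`. Let `v` be a unit vector and
`m := max( sup_{B̄_δ(x₀)} |∂_v² g|, 2 g(x₀) δ⁻² )`. Then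
`δ² |∂_v g(x₀)|² ≤ g(x₀) (g(x₀) + 2 δ² m)`. -/
theorem directional_derivative_sq_bound {n : ℕ}
    (g : EuclideanSpace ℝ (Fin n) → ℝ)
    (U : Set (EuclideanSpace ℝ (Fin n))) (hU : IsOpen U)
    (x₀ : EuclideanSpace ℝ (Fin n)) (δ : ℝ) (hδ : 0 < δ)
    (hball : Metric.closedBall x₀ δ ⊆ U)
    (hg : ContDiffOn ℝ 2 g U)
    (hnonneg : ∀ x ∈ Metric.closedBall x₀ δ, 0 ≤ g x)
    (v : EuclideanSpace ℝ (Fin n)) (hv : ‖v‖ = 1)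
    (m : ℝ)
    (hm : m = max
      (sSup ((fun x => |fderiv ℝ (fun y => fderiv ℝ g y v) x v|) ''
        Metric.closedBall x₀ δ))
      (2 * g x₀ / δ ^ 2)) :
    δ ^ 2 * |fderiv ℝ g x₀ v| ^ 2 ≤ g x₀ * (g x₀ + 2 * δ ^ 2 * m) := by
  set D : EuclideanSpace ℝ (Fin n) → ℝ := fun y => fderiv ℝ g y v
  have hD : ContDiffOn ℝ 1 D U :=
    (hg.fderiv_of_isOpen hU (by norm_num)).clm_apply contDiffOn_const
  have hdiff : ∀ x ∈ Metric.closedBall x₀ δ, DifferentiableAt ℝ g x := fun x hx =>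
    (hg.differentiableOn (by norm_num)).differentiableAt (hU.mem_nhds (hball hx))
  have hdiffD : ∀ x ∈ Metric.closedBall x₀ δ, DifferentiableAt ℝ D x := fun x hx =>
    (hD.differentiableOn (by norm_num)).differentiableAt (hU.mem_nhds (hball hx))
  have hcont : ContinuousOn (fun x => |fderiv ℝ D x v|) (Metric.closedBall x₀ δ) :=
    (((hD.continuousOn_fderiv_of_isOpen hU le_rfl).clm_apply
      continuousOn_const).mono hball).abs
  have hbound : ∀ x ∈ Metric.closedBall x₀ δ, |fderiv ℝ D x v| ≤ m := fun x hx => by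
    rw [hm]
    exact le_max_of_le_left (le_csSup
      ((isCompact_closedBall x₀ δ).bddAbove_image hcont) (mem_image_of_mem _ hx))
  have hx₀ : x₀ ∈ Metric.closedBall x₀ δ := Metric.mem_closedBall_self hδ.le
  have htaylor : ∀ ε : ℝ, |ε| = 1 → ∀ s ∈ Icc 0 δ,
      0 ≤ g x₀ + ε * D x₀ * s + m * s ^ 2 / 2 := by
    intro ε hε s hs
    have hmem : ∀ t ∈ Icc 0 δ, x₀ + (ε * t) • v ∈ Metric.closedBall x₀ δ := by
      intro t ht
      simpa [norm_smul, hε, hv, abs_of_nonneg ht.1] using ht.2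
    have h := le_taylor_of_second_deriv_le (m := m)
      (fun t ht => hasDerivAt_comp_add_smul (hdiff _ (hmem t ht)))
      (fun t ht => (hasDerivAt_comp_add_smul (hdiffD _ (hmem t ht))).const_mul ε)
      (fun t ht => by
        rw [← mul_assoc, ← abs_mul_abs_self ε, hε, one_mul, one_mul]
        exact (le_abs_self _).trans (hbound _ (hmem t ht))) hs
    simpa using (hnonneg _ (hmem s hs)).trans h
  have habs : ∀ s ∈ Icc 0 δ, |D x₀| * s ≤ g x₀ + m * s ^ 2 / 2 := by
    intro s hs
    have h1 := htaylor 1 (by simp) s hs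
    have h2 := htaylor (-1) (by simp) s hs
    rcases abs_cases (D x₀) with h | h <;> rw [h.1] <;> linarith
  change δ ^ 2 * |D x₀| ^ 2 ≤ _
  rcases (hnonneg x₀ hx₀).eq_or_lt with h0 | h0
  · have hmin : IsLocalMin g x₀ := by
      filter_upwards [Metric.closedBall_mem_nhds x₀ hδ] with x hx
      rw [← h0]
      exact hnonneg x hx
    simp [D, hmin.fderiv_eq_zero, ← h0]
  · have hm2 : 2 * g x₀ / δ ^ 2 ≤ m := hm ▸ le_max_right _ _
    have hmpos : 0 < m := lt_of_lt_of_le (by positivity) hm2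
    have hsδ : √(2 * g x₀ / m) ≤ δ := by
      refine (Real.sqrt_le_left hδ.le).2 ?_
      rw [div_le_iff₀ hmpos]
      rw [div_le_iff₀ (by positivity)] at hm2
      linarith
    have hsq : √(2 * g x₀ / m) ^ 2 = 2 * g x₀ / m := Real.sq_sqrt (by positivity)
    have h := habs _ ⟨Real.sqrt_nonneg _, hsδ⟩
    have hle : |D x₀| * √(2 * g x₀ / m) ≤ 2 * g x₀ := by
      refine h.trans_eq ?_
      rw [hsq]
      field_simp
      ring
    have hle2 := pow_le_pow_left₀ (by positivity) hle 2
    rw [mul_pow, hsq, ← mul_div_assoc, div_le_iff₀ hmpos] at hle2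
    have hfin : |D x₀| ^ 2 ≤ 2 * g x₀ * m := by
      refine le_of_mul_le_mul_right ?_ (show 0 < 2 * g x₀ by positivity)
      linarith
    nlinarith [mul_le_mul_of_nonneg_left hfin (sq_nonneg δ), sq_nonneg (g x₀)]
end

section
/- Let Ω ⊆ ℝⁿ be open and let g be a twice continuously differentiable real-valued function on Ω with g ≥ 0 on Ω. Let K ⊆ Ω be compact and let M ⊆ Ω be compact with K contained in the interior of M. Then there exists a constant C > 0 (depending only on n, K and M) such that for all x ∈ K: δ² Σ_{|α|=1} |∂^α g(x)| ≤ C √(g(x)) √( μ*_{M,2}(g) ), where δ > 0 is any radius with B_δ(K) ⊆ M. -/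
open Set

/-- `|g|_l(x) := Σ_{|α|=l} |∂^α g(x)|`, realized as the sum, over all `l`-tuples of
coordinate directions, of the absolute values of the corresponding iterated
directional derivatives of `g` at `x`. -/
noncomputable def absDerivSum {n : ℕ} {F : Type*} [NormedAddCommGroup F]
    [NormedSpace ℝ F] (l : ℕ) (g : EuclideanSpace ℝ (Fin n) → F)
    (x : EuclideanSpace ℝ (Fin n)) : ℝ :=
  ∑ v : Fin l → Fin n,
    ‖iteratedFDeriv ℝ l g x (fun j => EuclideanSpace.single (v j) (1:ℝ))‖

/-- `μ_{K,l}(g) := sup_{x ∈ K} |g|_l(x)`. -/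
noncomputable def mu {n : ℕ} {F : Type*} [NormedAddCommGroup F] [NormedSpace ℝ F]
    (K : Set (EuclideanSpace ℝ (Fin n))) (l : ℕ)
    (g : EuclideanSpace ℝ (Fin n) → F) : ℝ :=
  sSup (absDerivSum l g '' K)

/-- `μ*_{K,k}(g) := max_{l ≤ k} μ_{K,l}(g)`. -/
noncomputable def muStar {n : ℕ} {F : Type*} [NormedAddCommGroup F] [NormedSpace ℝ F]
    (K : Set (EuclideanSpace ℝ (Fin n))) (k : ℕ)
    (g : EuclideanSpace ℝ (Fin n) → F) : ℝ :=
  sSup ((fun l => mu K l g) '' {l | l ≤ k})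

/-- Second-order Taylor upper bound at the left endpoint, from an upper bound on the second
derivative. -/
lemma le_taylor_two_of_second_deriv_le {f f' f'' : ℝ → ℝ} {b μ : ℝ}
    (hf : ∀ t ∈ Icc 0 b, HasDerivAt f (f' t) t)
    (hf' : ∀ t ∈ Icc 0 b, HasDerivAt f' (f'' t) t)
    (hμ : ∀ t ∈ Icc 0 b, f'' t ≤ μ) {t : ℝ} (ht : t ∈ Icc 0 b) :
    f t ≤ f 0 + t * f' 0 + μ * t ^ 2 / 2 := by
  have h0 : (0 : ℝ) ∈ Icc 0 b := ⟨le_rfl, ht.1.trans ht.2⟩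
  have d1 : ∀ s ∈ Icc 0 b, HasDerivAt (fun s => μ * s - f' s) (μ - f'' s) s := fun s hs => by
    refine (((hasDerivAt_id s).const_mul μ).sub (hf' s hs)).congr_deriv ?_
    rw [mul_one]
  have m1 : MonotoneOn (fun s => μ * s - f' s) (Icc 0 b) := by
    refine monotoneOn_of_deriv_nonneg (convex_Icc 0 b)
      (fun s hs => (d1 s hs).continuousAt.continuousWithinAt)
      (fun s hs => (d1 s (interior_subset hs)).differentiableAt.differentiableWithinAt)
      (fun s hs => ?_)
    rw [(d1 s (interior_subset hs)).deriv]
    exact sub_nonneg.2 (hμ s (interior_subset hs))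
  have d2 : ∀ s ∈ Icc 0 b, HasDerivAt (fun s => μ * s ^ 2 / 2 + s * f' 0 - f s)
      (μ * s + f' 0 - f' s) s := fun s hs => by
    have h := ((((hasDerivAt_id s).pow 2).const_mul μ).div_const 2).add
      ((hasDerivAt_id s).mul_const (f' 0)) |>.sub (hf s hs)
    refine h.congr_deriv ?_
    simp only [id]
    ring
  have m2 : MonotoneOn (fun s => μ * s ^ 2 / 2 + s * f' 0 - f s) (Icc 0 b) := by
    refine monotoneOn_of_deriv_nonneg (convex_Icc 0 b)
      (fun s hs => (d2 s hs).continuousAt.continuousWithinAt)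
      (fun s hs => (d2 s (interior_subset hs)).differentiableAt.differentiableWithinAt)
      (fun s hs => ?_)
    rw [(d2 s (interior_subset hs)).deriv]
    have := m1 h0 (interior_subset hs) (interior_subset hs).1
    simp only at this
    linarith
  have := m2 h0 ht ht.1
  simp only at this
  linarith

/-- A number controlled by `c / t + μ t / 2` for all `t ∈ (0, δ]` is controlled by `√c √μ`. -/
lemma sq_mul_le_sqrt_mul_sqrt {a c μ δ : ℝ} (hδ : 0 < δ) (hc : 0 ≤ c) (hcμ : c ≤ μ)
    (h : ∀ t ∈ Icc 0 δ, t * a ≤ c + μ * t ^ 2 / 2) :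
    δ ^ 2 * a ≤ (δ + δ ^ 3) * (√c * √μ) := by
  rcases hc.eq_or_lt with rfl | hc
  · simp only [Real.sqrt_zero, zero_mul, mul_zero]
    by_contra! hpos
    have ha : 0 < a := by
      by_contra! h'
      nlinarith [sq_nonneg δ]
    rcases hcμ.eq_or_lt with rfl | hμ
    · nlinarith [h δ ⟨hδ.le, le_rfl⟩, mul_pos hδ ha]
    have ht : 0 < min δ (a / μ) := lt_min hδ (div_pos ha hμ)
    have h1 := h _ ⟨ht.le, min_le_left _ _⟩
    have h2 : min δ (a / μ) * μ ≤ a := (le_div_iff₀ hμ).1 (min_le_right _ _)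
    nlinarith
  · have hμ : 0 < μ := hc.trans_le hcμ
    have hp : 0 < √c := Real.sqrt_pos.2 hc
    have hq : 0 < √μ := Real.sqrt_pos.2 hμ
    have hpq : √c ≤ √μ := Real.sqrt_le_sqrt hcμ
    have h1 := h (√c / √μ * δ) ⟨by positivity,
      mul_le_of_le_one_left hδ.le ((div_le_one hq).2 hpq)⟩
    have e1 : c = √c ^ 2 := (Real.sq_sqrt hc.le).symm
    have e2 : μ = √μ ^ 2 := (Real.sq_sqrt hμ.le).symm
    generalize √c = p at *
    generalize √μ = q at *
    subst e1 e2
    have h2 : δ * a ≤ p * q * (1 + δ ^ 2 / 2) := by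
      have := mul_le_mul_of_nonneg_left h1 (div_pos hq hp).le
      field_simp at this
      nlinarith
    nlinarith [mul_le_mul_of_nonneg_left h2 hδ.le,
      mul_pos (mul_pos hp hq) (pow_pos hδ 3)]

section AbsDerivSum

variable {n : ℕ} {F : Type*} [NormedAddCommGroup F] [NormedSpace ℝ F]
  {g : EuclideanSpace ℝ (Fin n) → F} {Ω M : Set (EuclideanSpace ℝ (Fin n))}

lemma absDerivSum_continuousOn {k l : ℕ} (hΩ : IsOpen Ω) (hg : ContDiffOn ℝ k g Ω)
    (hl : l ≤ k) : ContinuousOn (absDerivSum l g) Ω := by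
  have h : ContinuousOn (iteratedFDeriv ℝ l g) Ω :=
    (hg.continuousOn_iteratedFDerivWithin (by exact_mod_cast hl) hΩ.uniqueDiffOn).congr
      fun x hx => (iteratedFDerivWithin_of_isOpen l hΩ hx).symm
  refine continuousOn_finsetSum _ fun v _ => ContinuousOn.norm ?_
  exact (ContinuousMultilinearMap.apply ℝ (fun _ : Fin l => EuclideanSpace ℝ (Fin n)) F
    (fun j => EuclideanSpace.single (v j) (1 : ℝ))).continuous.comp_continuousOn h

lemma absDerivSum_le_muStar {k l : ℕ} (hΩ : IsOpen Ω) (hg : ContDiffOn ℝ k g Ω)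
    (hM : IsCompact M) (hMΩ : M ⊆ Ω) (hl : l ≤ k) {y : EuclideanSpace ℝ (Fin n)} (hy : y ∈ M) :
    absDerivSum l g y ≤ muStar M k g :=
  (le_csSup (hM.bddAbove_image ((absDerivSum_continuousOn hΩ hg hl).mono hMΩ))
      (mem_image_of_mem _ hy)).trans
    (le_csSup ((finite_Iic k).image fun l => mu M l g).bddAbove
      (mem_image_of_mem (fun l => mu M l g) hl))

lemma norm_iteratedFDeriv_single_le_absDerivSum {l : ℕ} (v : Fin l → Fin n)
    (y : EuclideanSpace ℝ (Fin n)) :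
    ‖iteratedFDeriv ℝ l g y (fun j => EuclideanSpace.single (v j) (1 : ℝ))‖
      ≤ absDerivSum l g y :=
  Finset.single_le_sum
    (f := fun v : Fin l → Fin n =>
      ‖iteratedFDeriv ℝ l g y (fun j => EuclideanSpace.single (v j) (1 : ℝ))‖)
    (fun _ _ => norm_nonneg _) (Finset.mem_univ v)

lemma norm_le_muStar {k : ℕ} (hΩ : IsOpen Ω) (hg : ContDiffOn ℝ k g Ω)
    (hM : IsCompact M) (hMΩ : M ⊆ Ω) {y : EuclideanSpace ℝ (Fin n)} (hy : y ∈ M) :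
    ‖g y‖ ≤ muStar M k g := by
  simpa [absDerivSum] using absDerivSum_le_muStar hΩ hg hM hMΩ (Nat.zero_le k) hy

lemma norm_fderiv_fderiv_single_le_muStar (hΩ : IsOpen Ω) (hg : ContDiffOn ℝ 2 g Ω)
    (hM : IsCompact M) (hMΩ : M ⊆ Ω) (i : Fin n) {y : EuclideanSpace ℝ (Fin n)} (hy : y ∈ M) :
    ‖fderiv ℝ (fderiv ℝ g) y (EuclideanSpace.single i 1) (EuclideanSpace.single i 1)‖
      ≤ muStar M 2 g := by
  have h := norm_iteratedFDeriv_single_le_absDerivSum (g := g) (fun _ : Fin 2 => i) y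
  rw [iteratedFDeriv_two_apply] at h
  exact h.trans (absDerivSum_le_muStar hΩ (by exact_mod_cast hg) hM hMΩ le_rfl hy)

lemma absDerivSum_one (x : EuclideanSpace ℝ (Fin n)) :
    absDerivSum 1 g x = ∑ i, ‖fderiv ℝ g x (EuclideanSpace.single i 1)‖ := by
  refine Fintype.sum_equiv (Equiv.funUnique (Fin 1) (Fin n)) _ _ fun v => ?_
  rw [iteratedFDeriv_one_apply]
  rfl

end AbsDerivSum

/-- Taylor bound along the segment `[x, x + δ u]` for a `C²` function. -/
lemma le_taylor_two_of_fderiv_fderiv_le {E : Type*} [NormedAddCommGroup E] [NormedSpace ℝ E]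
    {g : E → ℝ} {Ω : Set E} (hΩ : IsOpen Ω) (hg : ContDiffOn ℝ 2 g Ω) {x u : E} {δ μ : ℝ}
    (hseg : ∀ t ∈ Icc 0 δ, x + t • u ∈ Ω)
    (hμ : ∀ t ∈ Icc 0 δ, fderiv ℝ (fderiv ℝ g) (x + t • u) u u ≤ μ)
    {t : ℝ} (ht : t ∈ Icc 0 δ) :
    g (x + t • u) ≤ g x + t * fderiv ℝ g x u + μ * t ^ 2 / 2 := by
  have line (s : ℝ) : HasDerivAt (fun s : ℝ => x + s • u) u s := by
    simpa using ((hasDerivAt_id s).smul_const u).const_add x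
  have hd1 : ∀ y ∈ Ω, DifferentiableAt ℝ g y := fun y hy =>
    (hg.contDiffAt (hΩ.mem_nhds hy)).differentiableAt (by norm_num)
  have hd2 : ∀ y ∈ Ω, DifferentiableAt ℝ (fderiv ℝ g) y := fun y hy =>
    ((hg.contDiffAt (hΩ.mem_nhds hy)).fderiv_right (m := 1) (by norm_num)).differentiableAt
      (by norm_num)
  have h1 : ∀ s ∈ Icc 0 δ, HasDerivAt (fun s : ℝ => g (x + s • u))
      (fderiv ℝ g (x + s • u) u) s := fun s hs =>
    (hd1 _ (hseg s hs)).hasFDerivAt.comp_hasDerivAt s (line s)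
  have h2 : ∀ s ∈ Icc 0 δ, HasDerivAt (fun s : ℝ => fderiv ℝ g (x + s • u) u)
      (fderiv ℝ (fderiv ℝ g) (x + s • u) u u) s := fun s hs => by
    have h : HasDerivAt (fun s : ℝ => fderiv ℝ g (x + s • u))
        (fderiv ℝ (fderiv ℝ g) (x + s • u) u) s :=
      (hd2 _ (hseg s hs)).hasFDerivAt.comp_hasDerivAt s (line s)
    exact (ContinuousLinearMap.apply ℝ ℝ u).hasFDerivAt.comp_hasDerivAt s h
  simpa only [zero_smul, add_zero] using le_taylor_two_of_second_deriv_le h1 h2 hμ ht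

/-- Interior bound for a first partial derivative of a nonnegative `C²` function. -/
lemma sq_mul_norm_fderiv_single_le {n : ℕ} {Ω M : Set (EuclideanSpace ℝ (Fin n))}
    (hΩ : IsOpen Ω) (hM : IsCompact M) (hMΩ : M ⊆ Ω) {g : EuclideanSpace ℝ (Fin n) → ℝ}
    (hg : ContDiffOn ℝ 2 g Ω) (hg0 : ∀ x ∈ Ω, 0 ≤ g x) {δ : ℝ} (hδ : 0 < δ)
    {x : EuclideanSpace ℝ (Fin n)} (hball : Metric.closedBall x δ ⊆ M) (i : Fin n) :
    δ ^ 2 * ‖fderiv ℝ g x (EuclideanSpace.single i 1)‖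
      ≤ (δ + δ ^ 3) * (√(g x) * √(muStar M 2 g)) := by
  have hx : x ∈ M := hball (Metric.mem_closedBall_self hδ.le)
  set e : EuclideanSpace ℝ (Fin n) := EuclideanSpace.single i 1 with he
  have hmem : ∀ u : EuclideanSpace ℝ (Fin n), ‖u‖ = 1 → ∀ t ∈ Icc 0 δ, x + t • u ∈ M := by
    intro u hu t ht
    refine hball ?_
    simpa [norm_smul, hu, abs_of_nonneg ht.1] using ht.2
  have hen : ‖e‖ = 1 := by simp [he]
  have key : ∀ u : EuclideanSpace ℝ (Fin n), ‖u‖ = 1 →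
      (∀ y, fderiv ℝ (fderiv ℝ g) y u u = fderiv ℝ (fderiv ℝ g) y e e) →
      ∀ t ∈ Icc 0 δ, 0 ≤ g x + t * fderiv ℝ g x u + muStar M 2 g * t ^ 2 / 2 := by
    intro u hu huu t ht
    refine (hg0 _ (hMΩ (hmem u hu t ht))).trans
      (le_taylor_two_of_fderiv_fderiv_le hΩ hg (fun s hs => hMΩ (hmem u hu s hs))
        (fun s hs => ?_) ht)
    rw [huu]
    exact (Real.le_norm_self _).trans
      (norm_fderiv_fderiv_single_le_muStar hΩ hg hM hMΩ i (hmem u hu s hs))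
  refine sq_mul_le_sqrt_mul_sqrt hδ (hg0 x (hMΩ hx))
    ((Real.le_norm_self _).trans (norm_le_muStar hΩ (by exact_mod_cast hg) hM hMΩ hx))
    fun t ht => ?_
  have h1 := key e hen (fun _ => rfl) t ht
  have h2 := key (-e) (by rw [norm_neg, hen]) (fun y => by simp) t ht
  rw [map_neg] at h2
  rw [Real.norm_eq_abs]
  rcases abs_cases (fderiv ℝ g x e) with ⟨h, -⟩ | ⟨h, -⟩ <;> rw [h] <;> linarith

/-- For `g` twice continuously differentiable and nonnegative on an open `Ω ⊆ ℝⁿ`,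
`K ⊆ Ω` compact and `M ⊆ Ω` compact with `K ⊆ interior M`, there is `C > 0`
(depending only on `n, K, M`) such that for every radius `δ > 0` with
`B_δ(K) ⊆ M` and every `x ∈ K`:
`δ² Σ_{|α|=1} |∂^α g(x)| ≤ C √(g(x)) √(μ*_{M,2}(g))`. -/
theorem sqrt_gradient_bound {n : ℕ}
    (Ω : Set (EuclideanSpace ℝ (Fin n))) (hΩ : IsOpen Ω)
    (K M : Set (EuclideanSpace ℝ (Fin n)))
    (hK : IsCompact K) (hKΩ : K ⊆ Ω) (hM : IsCompact M) (hMΩ : M ⊆ Ω)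
    (hKM : K ⊆ interior M) :
    ∃ C > (0:ℝ), ∀ (g : EuclideanSpace ℝ (Fin n) → ℝ),
      ContDiffOn ℝ 2 g Ω → (∀ x ∈ Ω, 0 ≤ g x) →
      ∀ δ > (0:ℝ), {x | ∃ x₀ ∈ K, dist x x₀ ≤ δ} ⊆ M →
      ∀ x ∈ K, δ ^ 2 * absDerivSum 1 g x ≤
        C * Real.sqrt (g x) * Real.sqrt (muStar M 2 g) := by
  set D := Metric.diam M
  have hD0 : 0 ≤ D := Metric.diam_nonneg
  refine ⟨n * (D + D ^ 3) + 1, by positivity, fun g hg hg0 δ hδ hδM x hx => ?_⟩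
  have hball : Metric.closedBall x δ ⊆ M := fun y hy => hδM ⟨x, hx, hy⟩
  have hδD : ∀ _ : Fin n, δ ≤ D := fun i => by
    have hy : x + δ • EuclideanSpace.single i (1 : ℝ) ∈ M :=
      hball (by simp [norm_smul, abs_of_pos hδ])
    have := Metric.dist_le_diam_of_mem hM.isBounded hy
      (hball (Metric.mem_closedBall_self hδ.le))
    simpa [norm_smul, abs_of_pos hδ] using this
  have hs : 0 ≤ √(g x) * √(muStar M 2 g) := by positivity
  calc δ ^ 2 * absDerivSum 1 g x
      = ∑ i, δ ^ 2 * ‖fderiv ℝ g x (EuclideanSpace.single i 1)‖ := by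
        rw [absDerivSum_one, Finset.mul_sum]
    _ ≤ ∑ _i : Fin n, (D + D ^ 3) * (√(g x) * √(muStar M 2 g)) := by
        refine Finset.sum_le_sum fun i _ =>
          (sq_mul_norm_fderiv_single_le hΩ hM hMΩ hg hg0 hδ hball i).trans ?_
        have := hδD i
        gcongr
    _ = n * (D + D ^ 3) * (√(g x) * √(muStar M 2 g)) := by simp [mul_assoc]
    _ ≤ (n * (D + D ^ 3) + 1) * √(g x) * √(muStar M 2 g) := by linarith
end

section
/- Let Ω ⊆ ℝⁿ be open, K ⊆ Ω compact, and M ⊆ Ω compact with K contained in the interior of M. For every integer k ≥ 0 there exists a constant C_k > 0 (depending only on n, k, K and M) with the following property: for every smooth u : Ω → ℂ with compact support contained in K, every smooth real-valued φ on Ω, every λ ∈ (0,1] such that |∇φ(x)| ≥ λ for all x ∈ K, and every ω ≥ 1, one has ω^k · |∫_Ω u(x) e^{i ω φ(x)} dx| ≤ C_k · max{1, μ*_{M,k+1}(φ)^{2k²}} · λ^{−2k} · Σ_{|α| ≤ k} sup_{x∈K} |∂^α u(x)|. -/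
open Set

open scoped Gradient

/-- The operator norm of a multilinear map on Euclidean space is at most the sum of the norms of its
values on tuples of coordinate vectors. -/
lemma ContinuousMultilinearMap.norm_le_sum_single {n l : ℕ} {F : Type*} [NormedAddCommGroup F]
    [NormedSpace ℝ F]
    (f : ContinuousMultilinearMap ℝ (fun _ : Fin l => EuclideanSpace ℝ (Fin n)) F) :
    ‖f‖ ≤ ∑ v : Fin l → Fin n, ‖f (fun j => EuclideanSpace.single (v j) (1 : ℝ))‖ := by
  refine f.opNorm_le_bound (by positivity) fun m => ?_
  have hm : m = fun j => ∑ i, m j i • EuclideanSpace.single i (1 : ℝ) := by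
    funext j
    ext i
    simp [Finset.sum_apply, Pi.single_apply]
  conv_lhs => rw [hm, f.map_sum]
  refine (norm_sum_le _ _).trans ?_
  rw [Finset.sum_mul]
  refine Finset.sum_le_sum fun v _ => ?_
  rw [f.map_smul_univ, norm_smul, mul_comm, norm_prod]
  gcongr with j
  exact PiLp.norm_apply_le (m j) (v j)

/-- The components of the inversion `p ↦ p / |p|²`. -/
noncomputable def inversionCoord {n : ℕ} (j : Fin n) (p : EuclideanSpace ℝ (Fin n)) : ℝ :=
  p j / ‖p‖ ^ 2

lemma contDiffOn_inversionCoord {n : ℕ} (j : Fin n) :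
    ContDiffOn ℝ (⊤ : ℕ∞) (inversionCoord j) {0}ᶜ := by
  intro p hp
  have hp : p ≠ 0 := hp
  refine ContDiffAt.contDiffWithinAt ?_
  refine ContDiffAt.div (EuclideanSpace.proj (𝕜 := ℝ) j).contDiff.contDiffAt
    (contDiff_norm_sq ℝ).contDiffAt ?_
  simpa using hp

lemma inversionCoord_eq_smul {n : ℕ} (j : Fin n) {s : ℝ} (hs : s ≠ 0)
    (p : EuclideanSpace ℝ (Fin n)) :
    inversionCoord j p = s⁻¹ • inversionCoord j (s⁻¹ • p) := by
  by_cases hp : p = 0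
  · simp [inversionCoord, hp]
  have hp' : ‖p‖ ≠ 0 := by simpa using hp
  simp only [inversionCoord, norm_smul, PiLp.smul_apply, smul_eq_mul, norm_inv, Real.norm_eq_abs,
    mul_pow, inv_pow, sq_abs]
  field_simp

lemma exists_bound_inversionCoord (n k : ℕ) :
    ∃ C : ℝ, 0 ≤ C ∧ ∀ (j : Fin n), ∀ l ≤ k, ∀ p : EuclideanSpace ℝ (Fin n), ‖p‖ = 1 →
      ‖iteratedFDerivWithin ℝ l (inversionCoord j) {0}ᶜ p‖ ≤ C := by
  have h (j : Fin n) (l : ℕ) : ∃ C : ℝ, ∀ p ∈ Metric.sphere (0 : EuclideanSpace ℝ (Fin n)) 1,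
      ‖iteratedFDerivWithin ℝ l (inversionCoord j) {0}ᶜ p‖ ≤ C := by
    refine (isCompact_sphere _ _).exists_bound_of_continuousOn ?_
    refine ((contDiffOn_inversionCoord j).continuousOn_iteratedFDerivWithin
      (by exact_mod_cast le_top) isOpen_compl_singleton.uniqueDiffOn).mono ?_
    rintro p hp rfl
    simp at hp
  choose C hC using h
  refine ⟨∑ j, ∑ l ∈ Finset.range (k + 1), |C j l|, by positivity, fun j l hl p hp => ?_⟩
  calc _ ≤ C j l := hC j l p (by simpa using hp)
    _ ≤ |C j l| := le_abs_self _
    _ ≤ ∑ l ∈ Finset.range (k + 1), |C j l| :=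
      Finset.single_le_sum (f := fun l => |C j l|) (fun _ _ => abs_nonneg _)
        (Finset.mem_range.2 (Nat.lt_succ_of_le hl))
    _ ≤ _ := Finset.single_le_sum (f := fun j => ∑ l ∈ Finset.range (k + 1), |C j l|)
        (fun _ _ => by positivity) (Finset.mem_univ j)

section

variable {n : ℕ} {Ω : Set (EuclideanSpace ℝ (Fin n))} {φ : EuclideanSpace ℝ (Fin n) → ℝ}

lemma contDiffOn_gradient (hΩ : IsOpen Ω) (hφ : ContDiffOn ℝ (⊤ : ℕ∞) φ Ω) :
    ContDiffOn ℝ (⊤ : ℕ∞) (∇ φ) Ω :=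
  (InnerProductSpace.toDual ℝ (EuclideanSpace ℝ (Fin n))).symm.toContinuousLinearEquiv
    |>.contDiff.comp_contDiffOn (hφ.fderiv_of_isOpen hΩ (by norm_cast))

lemma norm_gradient (x : EuclideanSpace ℝ (Fin n)) : ‖∇ φ x‖ = ‖fderiv ℝ φ x‖ := by
  simp [gradient]

lemma norm_iteratedFDeriv_gradient (i : ℕ) (x : EuclideanSpace ℝ (Fin n)) :
    ‖iteratedFDeriv ℝ i (∇ φ) x‖ = ‖iteratedFDeriv ℝ (i + 1) φ x‖ := by
  rw [← norm_iteratedFDeriv_fderiv]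
  exact (InnerProductSpace.toDual ℝ (EuclideanSpace ℝ (Fin n))).symm.norm_iteratedFDeriv_comp_left
    (fderiv ℝ φ) x i

lemma isOpen_gradient_ne_zero (hΩ : IsOpen Ω) (hφ : ContDiffOn ℝ (⊤ : ℕ∞) φ Ω) :
    IsOpen {x | x ∈ Ω ∧ ∇ φ x ≠ 0} :=
  (contDiffOn_gradient hΩ hφ).continuousOn.isOpen_inter_preimage hΩ isOpen_compl_singleton

lemma contDiffOn_inversionCoord_gradient (hΩ : IsOpen Ω) (hφ : ContDiffOn ℝ (⊤ : ℕ∞) φ Ω)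
    (j : Fin n) :
    ContDiffOn ℝ (⊤ : ℕ∞) (fun x => inversionCoord j (∇ φ x)) {x | x ∈ Ω ∧ ∇ φ x ≠ 0} :=
  (contDiffOn_inversionCoord j).comp ((contDiffOn_gradient hΩ hφ).mono fun _ h => h.1)
    fun _ h => h.2

lemma norm_iteratedFDeriv_inversionCoord_gradient_le (hΩ : IsOpen Ω)
    (hφ : ContDiffOn ℝ (⊤ : ℕ∞) φ Ω) {j : Fin n} {l : ℕ} {C r : ℝ}
    (hC : ∀ i ≤ l, ∀ p : EuclideanSpace ℝ (Fin n), ‖p‖ = 1 →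
      ‖iteratedFDerivWithin ℝ i (inversionCoord j) {0}ᶜ p‖ ≤ C)
    {x : EuclideanSpace ℝ (Fin n)} (hx : x ∈ Ω) (hx0 : ∇ φ x ≠ 0)
    (hr : ∀ i, 1 ≤ i → i ≤ l → ‖iteratedFDeriv ℝ (i + 1) φ x‖ ≤ ‖∇ φ x‖ * r ^ i) :
    ‖iteratedFDeriv ℝ l (fun y => inversionCoord j (∇ φ y)) x‖ ≤
      ‖∇ φ x‖⁻¹ * (l.factorial * C * r ^ l) := by
  set s := ‖∇ φ x‖ with hs
  have hs0 : 0 < s := norm_pos_iff.2 hx0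
  set U := {x | x ∈ Ω ∧ ∇ φ x ≠ 0} with hU
  have hUo : IsOpen U := isOpen_gradient_ne_zero hΩ hφ
  have hxU : x ∈ U := ⟨hx, hx0⟩
  have hf : ContDiffOn ℝ (⊤ : ℕ∞) (∇ φ) U := (contDiffOn_gradient hΩ hφ).mono fun _ h => h.1
  have hF : ContDiffOn ℝ (⊤ : ℕ∞) (fun y => s⁻¹ • ∇ φ y) U := hf.const_smul s⁻¹
  have hmap : MapsTo (fun y => s⁻¹ • ∇ φ y) U {0}ᶜ := fun y hy => by
    simpa [hs0.ne'] using hy.2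
  have hl : ((l : ℕ∞) : WithTop ℕ∞) ≤ ((⊤ : ℕ∞) : WithTop ℕ∞) := by exact_mod_cast le_top
  have hcomp := (contDiffOn_inversionCoord j).comp hF hmap
  have heq : (fun y => inversionCoord j (∇ φ y)) =
      s⁻¹ • (inversionCoord j ∘ fun y => s⁻¹ • ∇ φ y) := by
    funext y
    exact inversionCoord_eq_smul j hs0.ne' _
  rw [heq, iteratedFDeriv_const_smul_apply
    ((hcomp.contDiffAt (hUo.mem_nhds hxU)).of_le (by exact_mod_cast le_top)), norm_smul, norm_inv,
    Real.norm_of_nonneg hs0.le]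
  gcongr
  rw [← iteratedFDerivWithin_of_isOpen l hUo hxU]
  refine norm_iteratedFDerivWithin_comp_le (contDiffOn_inversionCoord j) hF
    (by exact_mod_cast le_top) isOpen_compl_singleton.uniqueDiffOn hUo.uniqueDiffOn hmap hxU ?_ ?_
  · intro i hi
    refine hC i hi _ ?_
    rw [norm_smul, norm_inv, Real.norm_of_nonneg hs0.le, ← hs, inv_mul_cancel₀ hs0.ne']
  · intro i h1 hi
    rw [iteratedFDerivWithin_of_isOpen i hUo hxU]
    have := iteratedFDeriv_const_smul_apply (a := s⁻¹) (i := i)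
      ((hf.contDiffAt (hUo.mem_nhds hxU)).of_le (by exact_mod_cast le_top))
    have h2 : iteratedFDeriv ℝ i (fun y => s⁻¹ • ∇ φ y) x = s⁻¹ • iteratedFDeriv ℝ i (∇ φ) x := this
    rw [h2, norm_smul, norm_inv, Real.norm_of_nonneg hs0.le, norm_iteratedFDeriv_gradient,
      inv_mul_le_iff₀ hs0]
    exact hr i h1 hi

lemma sum_inversionCoord_mul_fderiv {x : EuclideanSpace ℝ (Fin n)} (hx : ∇ φ x ≠ 0) :
    ∑ j, inversionCoord j (∇ φ x) * fderiv ℝ φ x (EuclideanSpace.single j 1) = 1 := by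
  have h (j : Fin n) : fderiv ℝ φ x (EuclideanSpace.single j 1) = ∇ φ x j := by
    rw [← toDual_gradient, InnerProductSpace.toDual_apply_apply,
      EuclideanSpace.inner_single_right]
    simp
  have hx' : ‖∇ φ x‖ ^ 2 ≠ 0 := by simpa using hx
  simp only [h, inversionCoord, div_mul_eq_mul_div, ← Finset.sum_div]
  rw [div_eq_one_iff_eq hx', EuclideanSpace.real_norm_sq_eq]
  simp [sq]

end

section

variable {n : ℕ} {K U : Set (EuclideanSpace ℝ (Fin n))}

lemma contDiff_of_contDiffOn_of_eq_zero {E F : Type*} [NormedAddCommGroup E] [NormedSpace ℝ E]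
    [NormedAddCommGroup F] [NormedSpace ℝ F] {N : WithTop ℕ∞} {K U : Set E} (hK : IsClosed K)
    (hU : IsOpen U) (hKU : K ⊆ U) {f : E → F} (hf : ContDiffOn ℝ N f U) (h0 : ∀ x ∉ K, f x = 0) :
    ContDiff ℝ N f := by
  refine contDiff_iff_contDiffAt.2 fun x => ?_
  by_cases hx : x ∈ K
  · exact hf.contDiffAt (hU.mem_nhds (hKU hx))
  · exact (contDiffAt_const (c := (0 : F))).congr_of_eventuallyEq <|
      Filter.eventually_of_mem (hK.isOpen_compl.mem_nhds hx) fun y hy => h0 y hy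

lemma fderiv_eq_zero_of_eq_zero {E F : Type*} [NormedAddCommGroup E] [NormedSpace ℝ E]
    [NormedAddCommGroup F] [NormedSpace ℝ F] {K : Set E} (hK : IsClosed K)
    {f : E → F} (h0 : ∀ x ∉ K, f x = 0) {x : E} (hx : x ∉ K) : fderiv ℝ f x = 0 := by
  have h : f =ᶠ[nhds x] fun _ => 0 :=
    Filter.eventually_of_mem (hK.isOpen_compl.mem_nhds hx) fun y hy => h0 y hy
  rw [h.fderiv_eq]
  simp

/-- The divergence of the vector field `f g`. -/
noncomputable def divMul (g : Fin n → EuclideanSpace ℝ (Fin n) → ℝ)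
    (f : EuclideanSpace ℝ (Fin n) → ℂ) (x : EuclideanSpace ℝ (Fin n)) : ℂ :=
  ∑ j, fderiv ℝ (fun y => g j y • f y) x (EuclideanSpace.single j 1)

variable {g : Fin n → EuclideanSpace ℝ (Fin n) → ℝ} {f : EuclideanSpace ℝ (Fin n) → ℂ}

lemma contDiff_smul_of_eq_zero (hK : IsClosed K) (hU : IsOpen U) (hKU : K ⊆ U) {j : Fin n}
    (hg : ContDiffOn ℝ (⊤ : ℕ∞) (g j) U) (hf : ContDiff ℝ (⊤ : ℕ∞) f) (h0 : ∀ x ∉ K, f x = 0) :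
    ContDiff ℝ (⊤ : ℕ∞) (fun y => g j y • f y) :=
  contDiff_of_contDiffOn_of_eq_zero hK hU hKU (hg.smul hf.contDiffOn) fun x hx => by simp [h0 x hx]

lemma contDiff_divMul (hK : IsClosed K) (hU : IsOpen U) (hKU : K ⊆ U)
    (hg : ∀ j, ContDiffOn ℝ (⊤ : ℕ∞) (g j) U) (hf : ContDiff ℝ (⊤ : ℕ∞) f)
    (h0 : ∀ x ∉ K, f x = 0) : ContDiff ℝ (⊤ : ℕ∞) (divMul g f) :=
  ContDiff.sum fun j _ =>
    ((contDiff_smul_of_eq_zero hK hU hKU (hg j) hf h0).fderiv_right (by norm_cast)).clm_apply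
      contDiff_const

lemma divMul_eq_zero (hK : IsClosed K) (h0 : ∀ x ∉ K, f x = 0) {x : EuclideanSpace ℝ (Fin n)}
    (hx : x ∉ K) : divMul g f x = 0 :=
  Finset.sum_eq_zero fun j _ => by
    rw [fderiv_eq_zero_of_eq_zero hK (fun y hy => by simp [h0 y hy]) hx]
    rfl

lemma norm_iteratedFDeriv_smul_le_of_isOpen (hU : IsOpen U) {j : Fin n}
    (hg : ContDiffOn ℝ (⊤ : ℕ∞) (g j) U) (hf : ContDiff ℝ (⊤ : ℕ∞) f)
    {x : EuclideanSpace ℝ (Fin n)} (hx : x ∈ U) {l : ℕ} {b c r : ℝ}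
    (hb : ∀ i ≤ l, ‖iteratedFDeriv ℝ i (g j) x‖ ≤ b * r ^ i)
    (hc : ∀ i ≤ l, ‖iteratedFDeriv ℝ i f x‖ ≤ c * r ^ i) :
    ‖iteratedFDeriv ℝ l (fun y => g j y • f y) x‖ ≤ 2 ^ l * (b * c) * r ^ l := by
  rw [← iteratedFDerivWithin_of_isOpen l hU hx]
  refine (norm_iteratedFDerivWithin_smul_le hg hf.contDiffOn hU.uniqueDiffOn hx
    (by exact_mod_cast le_top)).trans ?_
  have h2 : (2 : ℝ) ^ l = ∑ i ∈ Finset.range (l + 1), (l.choose i : ℝ) := by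
    exact_mod_cast (Nat.sum_range_choose l).symm
  rw [h2, Finset.sum_mul, Finset.sum_mul]
  refine Finset.sum_le_sum fun i hi => ?_
  have hi' : i ≤ l := Nat.lt_succ_iff.1 (Finset.mem_range.1 hi)
  rw [iteratedFDerivWithin_of_isOpen i hU hx, iteratedFDerivWithin_of_isOpen (l - i) hU hx]
  calc _ ≤ (l.choose i : ℝ) * (b * r ^ i) * (c * r ^ (l - i)) :=
        mul_le_mul (mul_le_mul_of_nonneg_left (hb i hi') (by positivity)) (hc _ (Nat.sub_le _ _))
          (norm_nonneg _) (mul_nonneg (by positivity) ((norm_nonneg _).trans (hb i hi')))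
    _ = _ := by rw [← pow_mul_pow_sub r hi']; ring

lemma norm_iteratedFDeriv_divMul_le (hK : IsClosed K) (hU : IsOpen U) (hKU : K ⊆ U)
    (hg : ∀ j, ContDiffOn ℝ (⊤ : ℕ∞) (g j) U) (hf : ContDiff ℝ (⊤ : ℕ∞) f)
    (h0 : ∀ x ∉ K, f x = 0) {x : EuclideanSpace ℝ (Fin n)} (hx : x ∈ U) {l : ℕ} {b c r : ℝ}
    (hb : ∀ j, ∀ i ≤ l + 1, ‖iteratedFDeriv ℝ i (g j) x‖ ≤ b * r ^ i)
    (hc : ∀ i ≤ l + 1, ‖iteratedFDeriv ℝ i f x‖ ≤ c * r ^ i) :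
    ‖iteratedFDeriv ℝ l (divMul g f) x‖ ≤ n * (2 ^ (l + 1) * (b * c) * r ^ (l + 1)) := by
  have hs (j : Fin n) := contDiff_smul_of_eq_zero hK hU hKU (hg j) hf h0
  have hs' (j : Fin n) : ContDiff ℝ (⊤ : ℕ∞) (fderiv ℝ fun y => g j y • f y) :=
    (hs j).fderiv_right (by norm_cast)
  unfold divMul
  rw [iteratedFDeriv_fun_sum_apply fun j _ =>
    (((hs' j).clm_apply contDiff_const).contDiffAt).of_le (by exact_mod_cast le_top)]
  refine (norm_sum_le _ _).trans ((Finset.sum_le_card_nsmul _ _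
    (2 ^ (l + 1) * (b * c) * r ^ (l + 1)) fun j _ => ?_).trans_eq ?_)
  · refine (norm_iteratedFDeriv_clm_apply_const (hs' j).contDiffAt
      (by exact_mod_cast le_top)).trans ?_
    rw [norm_iteratedFDeriv_fderiv]
    simpa using norm_iteratedFDeriv_smul_le_of_isOpen hU (hg j) hf hx (hb j) hc
  · simp

open MeasureTheory

lemma integral_fderiv_apply_eq_zero {F : EuclideanSpace ℝ (Fin n) → ℂ} (hF : ContDiff ℝ 1 F)
    (hc : HasCompactSupport F) (v : EuclideanSpace ℝ (Fin n)) : ∫ x, fderiv ℝ F x v = 0 := by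
  have h := integral_mul_fderiv_eq_neg_fderiv_mul_of_integrable (𝕜 := ℂ) (μ := volume)
    (f := fun _ => (1 : ℂ)) (g := F) (v := v) (by simp)
    (by simpa using ((hF.continuous_fderiv one_ne_zero).clm_apply
      continuous_const).integrable_of_hasCompactSupport (hc.fderiv_apply ℝ v))
    (by simpa using hF.continuous.integrable_of_hasCompactSupport hc)
    (by simp) (fun x _ => (hF.differentiable one_ne_zero) x)
  simpa using h

/-- One step of the non-stationary phase method. -/
lemma integral_mul_exp_eq (hK : IsCompact K) (hU : IsOpen U) (hKU : K ⊆ U)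
    (hg : ∀ j, ContDiffOn ℝ (⊤ : ℕ∞) (g j) U) (hf : ContDiff ℝ (⊤ : ℕ∞) f)
    (h0 : ∀ x ∉ K, f x = 0) {φ : EuclideanSpace ℝ (Fin n) → ℝ}
    (hφ : ContDiffOn ℝ (⊤ : ℕ∞) φ U)
    (hgφ : ∀ x ∈ K, ∑ j, g j x * fderiv ℝ φ x (EuclideanSpace.single j 1) = 1) (ω : ℝ) :
    Complex.I * ω * ∫ x, f x * Complex.exp (Complex.I * ((ω : ℂ) * (φ x : ℂ))) =
      -∫ x, divMul g f x * Complex.exp (Complex.I * ((ω : ℂ) * (φ x : ℂ))) := by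
  set e : EuclideanSpace ℝ (Fin n) → ℂ :=
    fun x => Complex.exp (Complex.I * ((ω : ℂ) * (φ x : ℂ))) with he
  have hφC : ContDiffOn ℝ (⊤ : ℕ∞) (fun x => (φ x : ℂ)) U :=
    Complex.ofRealCLM.contDiff.comp_contDiffOn hφ
  have heU : ContDiffOn ℝ (⊤ : ℕ∞) e U :=
    (contDiffOn_const.mul (contDiffOn_const.mul hφC)).cexp
  have hint {h : EuclideanSpace ℝ (Fin n) → ℂ} (hh : ContDiff ℝ (⊤ : ℕ∞) h)
      (hh0 : ∀ x ∉ K, h x = 0) :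
      ContDiff ℝ (⊤ : ℕ∞) (fun x => h x * e x) ∧ HasCompactSupport (fun x => h x * e x) :=
    ⟨contDiff_of_contDiffOn_of_eq_zero hK.isClosed hU hKU (hh.contDiffOn.mul heU)
      fun x hx => by simp [hh0 x hx], HasCompactSupport.intro hK fun x hx => by simp [hh0 x hx]⟩
  have hs (j : Fin n) := contDiff_smul_of_eq_zero hK.isClosed hU hKU (hg j) hf h0
  have hF (j : Fin n) := hint (hs j) (fun x hx => by simp [h0 x hx])
  have hD (j : Fin n) := integral_fderiv_apply_eq_zero ((hF j).1.of_le (by exact_mod_cast le_top))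
    (hF j).2 (EuclideanSpace.single j 1)
  have hkey (x : EuclideanSpace ℝ (Fin n)) :
      ∑ j, fderiv ℝ (fun y => (g j y • f y) * e y) x (EuclideanSpace.single j 1) =
        divMul g f x * e x + Complex.I * ω * (f x * e x) := by
    by_cases hx : x ∈ K
    · have hxU := hU.mem_nhds (hKU hx)
      have hφd : HasFDerivAt φ (fderiv ℝ φ x) x :=
        ((hφ.contDiffAt hxU).differentiableAt (by simp)).hasFDerivAt
      have hed := ((Complex.ofRealCLM.hasFDerivAt.comp x hφd).const_mul
        (ω : ℂ) |>.const_mul Complex.I).cexp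
      have hterm (j : Fin n) :
          fderiv ℝ (fun y => (g j y • f y) * e y) x (EuclideanSpace.single j 1) =
          fderiv ℝ (fun y => g j y • f y) x (EuclideanSpace.single j 1) * e x +
            Complex.I * ω * (f x * e x) *
              ((g j x * fderiv ℝ φ x (EuclideanSpace.single j 1) : ℝ) : ℂ) := by
        have hd := (((hs j).differentiable (by simp)) x).hasFDerivAt.mul hed
        have hd' : HasFDerivAt (fun y => (g j y • f y) * e y) _ x := hd
        rw [hd'.fderiv]
        simp [he]
        ring
      simp only [hterm, Finset.sum_add_distrib, ← Finset.sum_mul, ← Finset.mul_sum]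
      rw [← Complex.ofReal_sum, hgφ x hx]
      simp [divMul]
    · rw [divMul_eq_zero hK.isClosed h0 hx, h0 x hx]
      simp only [zero_mul, mul_zero, add_zero]
      refine Finset.sum_eq_zero fun j _ => ?_
      rw [fderiv_eq_zero_of_eq_zero hK.isClosed (fun y hy => by simp [h0 y hy]) hx]
      rfl
  have hfi := hint hf h0
  have hdi := hint (contDiff_divMul hK.isClosed hU hKU hg hf h0)
    (fun x hx => divMul_eq_zero hK.isClosed h0 hx)
  have hsum : ∫ x, ∑ j, fderiv ℝ (fun y => (g j y • f y) * e y) x (EuclideanSpace.single j 1)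
      = 0 := by
    rw [integral_finsetSum]
    · exact Finset.sum_eq_zero fun j _ => hD j
    · intro j _
      exact (((hF j).1.continuous_fderiv (by simp)).clm_apply
        continuous_const).integrable_of_hasCompactSupport ((hF j).2.fderiv_apply ℝ _)
  simp only [hkey] at hsum
  rw [integral_add (hdi.1.continuous.integrable_of_hasCompactSupport hdi.2)
    ((hfi.1.continuous.integrable_of_hasCompactSupport hfi.2).const_mul _),
    integral_const_mul] at hsum
  linear_combination hsum

/-- The non-stationary phase estimate with abstract weights. -/
lemma pow_mul_norm_integral_mul_exp_le (hK : IsCompact K) (hU : IsOpen U) (hKU : K ⊆ U)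
    (hg : ∀ j, ContDiffOn ℝ (⊤ : ℕ∞) (g j) U) {φ : EuclideanSpace ℝ (Fin n) → ℝ}
    (hφ : ContDiffOn ℝ (⊤ : ℕ∞) φ U)
    (hgφ : ∀ x ∈ K, ∑ j, g j x * fderiv ℝ φ x (EuclideanSpace.single j 1) = 1)
    {ω b r : ℝ} (hω : 0 ≤ ω) (hb0 : 0 ≤ b) (hr : 0 ≤ r) (N m : ℕ) (hmN : m ≤ N)
    (hb : ∀ x ∈ K, ∀ j, ∀ i ≤ N, ‖iteratedFDeriv ℝ i (g j) x‖ ≤ b * r ^ i) (c : ℝ) (hc0 : 0 ≤ c)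
    (hf : ContDiff ℝ (⊤ : ℕ∞) f) (h0 : ∀ x ∉ K, f x = 0)
    (hc : ∀ x ∈ K, ∀ i ≤ m, ‖iteratedFDeriv ℝ i f x‖ ≤ c * r ^ i) :
    ω ^ m * ‖∫ x, f x * Complex.exp (Complex.I * ((ω : ℂ) * (φ x : ℂ)))‖ ≤
      (n * 2 ^ N * b * r) ^ m * c * volume.real K := by
  induction m generalizing f c with
  | zero =>
    rw [← setIntegral_eq_integral_of_forall_compl_eq_zero (s := K) fun x hx => by simp [h0 x hx]]
    simp only [pow_zero, one_mul]
    refine norm_setIntegral_le_of_norm_le_const hK.measure_lt_top fun x hx => ?_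
    have h1 : ‖Complex.exp (Complex.I * ((ω : ℂ) * (φ x : ℂ)))‖ = 1 := by
      rw [← Complex.ofReal_mul, Complex.norm_exp_I_mul_ofReal]
    simpa [h1] using hc x hx 0 le_rfl
  | succ m ih =>
    have hstep := congrArg norm (integral_mul_exp_eq hK hU hKU hg hf h0 hφ hgφ ω)
    simp only [norm_mul, Complex.norm_I, one_mul, norm_neg, Complex.norm_real,
      Real.norm_of_nonneg hω] at hstep
    have := ih (f := divMul g f) (Nat.le_of_succ_le hmN) (n * 2 ^ N * b * r * c) (by positivity)
      (contDiff_divMul hK.isClosed hU hKU hg hf h0)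
      (fun x hx => divMul_eq_zero hK.isClosed h0 hx) fun x hx i hi => by
        refine (norm_iteratedFDeriv_divMul_le hK.isClosed hU hKU hg hf h0 (hKU hx)
          (fun j i' hi' => hb x hx j i' (by omega)) (fun i' hi' => hc x hx i' (by omega))).trans ?_
        calc _ ≤ n * (2 ^ N * (b * c) * r ^ (i + 1)) := by
              gcongr
              · norm_num
              · omega
          _ = _ := by ring
    calc _ = ω ^ m * (ω * ‖∫ x, f x * Complex.exp (Complex.I * ((ω : ℂ) * (φ x : ℂ)))‖) := by ring
      _ ≤ _ := hstep ▸ this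
      _ = _ := by ring

end

section

variable {n : ℕ} {F : Type*} [NormedAddCommGroup F] [NormedSpace ℝ F]
  {Ω M : Set (EuclideanSpace ℝ (Fin n))} {g : EuclideanSpace ℝ (Fin n) → F}

lemma continuousOn_iteratedFDeriv_apply (hΩ : IsOpen Ω) (hg : ContDiffOn ℝ (⊤ : ℕ∞) g Ω) (l : ℕ)
    (m : Fin l → EuclideanSpace ℝ (Fin n)) :
    ContinuousOn (fun x => ‖iteratedFDeriv ℝ l g x m‖) Ω := by
  have h : ContinuousOn (iteratedFDeriv ℝ l g) Ω :=
    (hg.continuousOn_iteratedFDerivWithin (by exact_mod_cast le_top) hΩ.uniqueDiffOn).congr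
      fun x hx => (iteratedFDerivWithin_of_isOpen l hΩ hx).symm
  exact ((ContinuousMultilinearMap.apply ℝ _ F m).continuous.comp_continuousOn h).norm

lemma norm_iteratedFDeriv_le_muStar (hΩ : IsOpen Ω) (hM : IsCompact M) (hMΩ : M ⊆ Ω)
    (hg : ContDiffOn ℝ (⊤ : ℕ∞) g Ω) {x : EuclideanSpace ℝ (Fin n)} (hx : x ∈ M) {l k : ℕ}
    (hl : l ≤ k) : ‖iteratedFDeriv ℝ l g x‖ ≤ muStar M k g := by
  calc _ ≤ absDerivSum l g x := (iteratedFDeriv ℝ l g x).norm_le_sum_single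
    _ ≤ mu M l g := by
      refine le_csSup (hM.bddAbove_image ?_) (mem_image_of_mem _ hx)
      exact (continuousOn_finsetSum _ fun v _ =>
        continuousOn_iteratedFDeriv_apply hΩ hg l _).mono hMΩ
    _ ≤ _ := le_csSup (((finite_le_nat k).image _).bddAbove) ⟨l, hl, rfl⟩

end

/-- Stationary phase estimate: for `Ω ⊆ ℝⁿ` open, `K ⊆ Ω` compact, `M ⊆ Ω` compact
with `K ⊆ interior M`, and every `k ≥ 0`, there is `C_k > 0` (depending only on
`n, k, K, M`) such that for every smooth `u : Ω → ℂ` supported in `K`, every smooth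
real-valued `φ` on `Ω`, every `λ ∈ (0,1]` with `|∇φ| ≥ λ` on `K` and every `ω ≥ 1`:
`ω^k |∫_Ω u e^{iωφ}| ≤ C_k max{1, μ*_{M,k+1}(φ)^{2k²}} λ^{−2k} Σ_{|α|≤k} sup_K |∂^α u|`. -/
theorem stationary_phase {n : ℕ}
    (Ω : Set (EuclideanSpace ℝ (Fin n))) (hΩ : IsOpen Ω)
    (K M : Set (EuclideanSpace ℝ (Fin n)))
    (hK : IsCompact K) (hKΩ : K ⊆ Ω) (hM : IsCompact M) (hMΩ : M ⊆ Ω)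
    (hKM : K ⊆ interior M) (k : ℕ) :
    ∃ C > (0:ℝ), ∀ (u : EuclideanSpace ℝ (Fin n) → ℂ)
      (φ : EuclideanSpace ℝ (Fin n) → ℝ) (lam ω : ℝ),
      ContDiffOn ℝ (⊤ : ℕ∞) u Ω → Function.support u ⊆ K →
      ContDiffOn ℝ (⊤ : ℕ∞) φ Ω →
      lam ∈ Set.Ioc (0:ℝ) 1 → (∀ x ∈ K, lam ≤ ‖fderiv ℝ φ x‖) → 1 ≤ ω →
      ω ^ k * ‖∫ x in Ω, u x * Complex.exp (Complex.I * ((ω : ℂ) * (φ x : ℂ)))‖ ≤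
        C * max 1 (muStar M (k + 1) φ ^ (2 * k ^ 2)) * (lam ^ (2 * k))⁻¹ *
          ∑ l ∈ Finset.range (k + 1), ∑ v : Fin l → Fin n,
            sSup ((fun x =>
              ‖iteratedFDeriv ℝ l u x (fun j => EuclideanSpace.single (v j) (1:ℝ))‖)
              '' K) := by
  obtain ⟨C₀, hC₀, hC⟩ := exists_bound_inversionCoord n k
  set B : ℝ := k.factorial * C₀ with hB
  have hB0 : 0 ≤ B := by positivity
  refine ⟨(n * 2 ^ k * B) ^ k * MeasureTheory.volume.real K + 1, by positivity, ?_⟩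
  intro u φ lam ω hu huK hφ hlam hgrad hω
  obtain ⟨hlam0, hlam1⟩ := hlam
  have hu0 : ∀ x ∉ K, u x = 0 := fun x hx => Function.notMem_support.1 fun h => hx (huK h)
  have husmooth : ContDiff ℝ (⊤ : ℕ∞) u :=
    contDiff_of_contDiffOn_of_eq_zero hK.isClosed hΩ hKΩ hu hu0
  set S := ∑ l ∈ Finset.range (k + 1), ∑ v : Fin l → Fin n, sSup ((fun x =>
    ‖iteratedFDeriv ℝ l u x (fun j => EuclideanSpace.single (v j) (1:ℝ))‖) '' K) with hS
  have hsSup (l : ℕ) (v : Fin l → Fin n) : 0 ≤ sSup ((fun x =>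
      ‖iteratedFDeriv ℝ l u x (fun j => EuclideanSpace.single (v j) (1:ℝ))‖) '' K) := by
    refine Real.sSup_nonneg ?_
    rintro _ ⟨x, _, rfl⟩
    exact norm_nonneg _
  have hS0 : 0 ≤ S := Finset.sum_nonneg fun l _ => Finset.sum_nonneg fun v _ => hsSup l v
  set A := max 1 (muStar M (k + 1) φ) with hA
  have hA1 : 1 ≤ A := le_max_left _ _
  have hA0 : 0 < A := one_pos.trans_le hA1
  have hr1 : 1 ≤ A / lam := (one_le_div hlam0).2 (hlam1.trans hA1)
  have hgrad0 : ∀ x ∈ K, ∇ φ x ≠ 0 := fun x hx => by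
    rw [← norm_pos_iff, norm_gradient]
    exact hlam0.trans_le (hgrad x hx)
  have huS : ∀ x ∈ K, ∀ i ≤ k, ‖iteratedFDeriv ℝ i u x‖ ≤ S * (A / lam) ^ i := by
    intro x hx i hi
    refine le_trans ?_ (le_mul_of_one_le_right hS0 (one_le_pow₀ hr1))
    refine (iteratedFDeriv ℝ i u x).norm_le_sum_single.trans ?_
    refine le_trans (Finset.sum_le_sum fun v _ => ?_)
      (Finset.single_le_sum (f := fun l => ∑ v : Fin l → Fin n, sSup ((fun x =>
        ‖iteratedFDeriv ℝ l u x (fun j => EuclideanSpace.single (v j) (1:ℝ))‖) '' K))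
        (fun l _ => Finset.sum_nonneg fun v _ => hsSup l v)
        (Finset.mem_range.2 (Nat.lt_succ_of_le hi)))
    exact le_csSup (hK.bddAbove_image
      ((continuousOn_iteratedFDeriv_apply hΩ hu i _).mono hKΩ)) (mem_image_of_mem _ hx)
  have hgb : ∀ x ∈ K, ∀ j, ∀ i ≤ k, ‖iteratedFDeriv ℝ i (fun y => inversionCoord j (∇ φ y)) x‖ ≤
      (B / lam) * (A / lam) ^ i := by
    intro x hx j i hi
    have hle : lam ≤ ‖∇ φ x‖ := norm_gradient x ▸ hgrad x hx
    refine (norm_iteratedFDeriv_inversionCoord_gradient_le hΩ hφ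
      (fun i' hi' => hC j i' (hi'.trans hi)) (hKΩ hx) (hgrad0 x hx) (r := A / lam)
      fun i' h1 hi' => ?_).trans ?_
    · calc _ ≤ A := (norm_iteratedFDeriv_le_muStar hΩ hM hMΩ hφ
            (interior_subset (hKM hx)) (by omega)).trans (le_max_right _ _)
        _ = lam * (A / lam) ^ 1 := by field_simp
        _ ≤ _ := by gcongr
    · have : (i.factorial : ℝ) ≤ k.factorial := by exact_mod_cast Nat.factorial_le hi
      calc _ ≤ lam⁻¹ * (k.factorial * C₀ * (A / lam) ^ i) := by gcongr
        _ = _ := by rw [hB]; ring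
  have hmain := pow_mul_norm_integral_mul_exp_le hK (isOpen_gradient_ne_zero hΩ hφ)
    (fun x hx => ⟨hKΩ hx, hgrad0 x hx⟩) (contDiffOn_inversionCoord_gradient hΩ hφ)
    (hφ.mono fun _ h => h.1) (fun x hx => sum_inversionCoord_mul_fderiv (hgrad0 x hx))
    (zero_le_one.trans hω) (by positivity) (zero_le_one.trans hr1) k k le_rfl hgb S hS0
    husmooth hu0 huS
  rw [MeasureTheory.setIntegral_eq_integral_of_forall_compl_eq_zero fun x hx => by
    simp [hu0 x fun h => hx (hKΩ h)]]
  have hAk : A ^ k ≤ max 1 (muStar M (k + 1) φ ^ (2 * k ^ 2)) := by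
    rcases le_total (muStar M (k + 1) φ) 1 with h | h
    · rw [hA, max_eq_left h, one_pow]
      exact le_max_left _ _
    · rw [hA, max_eq_right h]
      exact (pow_le_pow_right₀ h (by nlinarith)).trans (le_max_right _ _)
  calc _ ≤ _ := hmain
    _ = (n * 2 ^ k * B) ^ k * MeasureTheory.volume.real K * A ^ k * (lam ^ (2 * k))⁻¹ * S := by
      have : (n * 2 ^ k * (B / lam) * (A / lam)) = (n * 2 ^ k * B) * A * (lam ^ 2)⁻¹ := by
        field_simp
      rw [this, mul_pow, mul_pow, inv_pow, ← pow_mul]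
      ring
    _ ≤ _ := by
      gcongr
      exact le_add_of_nonneg_right zero_le_one
end

section
/- Let Θ : ℝ → ℝ be continuous and non-increasing with 0 ≤ Θ(z) ≤ 1 for all z ∈ ℝ. Let t ≥ 0, x ∈ ℝ, and let σ : ℝ → ℝ be differentiable with σ'(s) = Θ(σ(s)) for all s ∈ [0,t] and σ(t) = x. Then x − t·Θ(x − t) ≤ σ(0) ≤ x − t·Θ(x). -/
open Set

/-- If `Θ : ℝ → ℝ` is continuous, non-increasing, with values in `[0,1]`, `t ≥ 0`,
and `σ` solves `σ'(s) = Θ(σ(s))` on `[0,t]` with `σ(t) = x`, then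
`x − t·Θ(x − t) ≤ σ(0) ≤ x − t·Θ(x)`. -/
theorem characteristic_flow_refined_bounds (Θ : ℝ → ℝ) (hΘc : Continuous Θ)
    (hΘmono : Antitone Θ) (hΘ : ∀ z, Θ z ∈ Set.Icc (0:ℝ) 1) (t x : ℝ) (ht : 0 ≤ t)
    (σ : ℝ → ℝ) (hσ : ∀ s ∈ Set.Icc (0:ℝ) t, HasDerivAt σ (Θ (σ s)) s)
    (hσt : σ t = x) :
    x - t * Θ (x - t) ≤ σ 0 ∧ σ 0 ≤ x - t * Θ x := by
  have mvt : ∀ a b, 0 ≤ a → a < b → b ≤ t →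
      ∃ c ∈ Set.Ioo a b, Θ (σ c) * (b - a) = σ b - σ a := by
    intro a b ha hab hb
    obtain ⟨c, hc, h⟩ := exists_hasDerivAt_eq_slope σ (fun s => Θ (σ s)) hab
      (fun s hs => (hσ s ⟨ha.trans hs.1, hs.2.trans hb⟩).continuousAt.continuousWithinAt)
      (fun s hs => hσ s ⟨ha.trans hs.1.le, hs.2.le.trans hb⟩)
    exact ⟨c, hc, (eq_div_iff (sub_pos.2 hab).ne').1 h⟩
  rcases ht.eq_or_lt with rfl | ht
  · simp [hσt]
  obtain ⟨c, ⟨hc0, hct⟩, hc⟩ := mvt 0 t le_rfl ht le_rfl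
  obtain ⟨d, -, hd⟩ := mvt c t hc0.le hct le_rfl
  have hd0 := mul_nonneg (hΘ (σ d)).1 (sub_pos.2 hct).le
  have hd1 := mul_le_of_le_one_left (sub_pos.2 hct).le (hΘ (σ d)).2
  have hlower := mul_le_mul_of_nonneg_left (hΘmono (show σ c ≤ x by linarith)) ht.le
  have hupper := mul_le_mul_of_nonneg_left (hΘmono (show x - t ≤ σ c by linarith)) ht.le
  constructor <;> linarith
end
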